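/- For all ε > 0 and α > 0 there exist a constant C > 0 (depending only on the Schottky data) and n₀ ∈ ℕ (depending on the Schottky data, ε and α) such that for all n ≥ n₀, setting τ = n^{−α}: Σ_{𝐚,𝐛 ∈ Z̄(τ)} |E[fix(Π(𝐚′)·Π(𝐛′)⁻¹)] − 1| ≤ C·( n·τ^{−δ} + n^{ε}·#PowerPairs(τ) + n^{ε−1}·τ^{−2δ} ), where δ is the Hausdorff dimension of the limit set Λ. -/

import Mathlib

open MeasureTheory

/-- `SL(2,ℝ)`. -/
abbrev SL2 : Type := Matrix.SpecialLinearGroup (Fin 2) ℝ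

/-- The Möbius transformation of `g ∈ SL(2,ℝ)` acting on `ℂ` (junk at the pole). -/
noncomputable def mobiusC (g : SL2) (z : ℂ) : ℂ :=
  ((g.1 0 0 : ℂ) * z + (g.1 0 1 : ℂ)) / ((g.1 1 0 : ℂ) * z + (g.1 1 1 : ℂ))

/-- The Möbius transformation of `g ∈ SL(2,ℝ)` acting on `ℝ` (junk at the pole). -/
noncomputable def mobiusR (g : SL2) (x : ℝ) : ℝ :=
  (g.1 0 0 * x + g.1 0 1) / (g.1 1 0 * x + g.1 1 1)

/-- The derivative `γ'(z) = (uz+v)⁻²` of the Möbius transformation of `g`. -/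
noncomputable def mobiusDerivC (g : SL2) (z : ℂ) : ℂ :=
  ((g.1 1 0 : ℂ) * z + (g.1 1 1 : ℂ))⁻¹ ^ 2

/-- The derivative `γ'(x) = (ux+v)⁻²` of the Möbius transformation of `g`, real version. -/
noncomputable def mobiusDerivR (g : SL2) (x : ℝ) : ℝ :=
  (g.1 1 0 * x + g.1 1 1)⁻¹ ^ 2

/-- The Möbius transformation of `g ∈ SL(2,ℝ)` acting on the Riemann sphere `ℂ ∪ {∞}`. -/
noncomputable def mobiusS (g : SL2) (z : OnePoint ℂ) : OnePoint ℂ :=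
  Option.elim z
    (if (g.1 1 0 : ℝ) = 0 then OnePoint.infty else (((g.1 0 0 / g.1 1 0 : ℝ) : ℂ) : OnePoint ℂ))
    (fun w => if ((g.1 1 0 : ℂ) * w + (g.1 1 1 : ℂ)) = 0 then OnePoint.infty
      else ((mobiusC g w : ℂ) : OnePoint ℂ))

/-- The involution `a ↦ ā = a + r mod 2r` on the alphabet `𝒜 = Fin (2r)`. -/
def wordBar {r : ℕ} (a : Fin (2 * r)) : Fin (2 * r) :=
  ⟨(a.1 + r) % (2 * r), Nat.mod_lt _ (Nat.lt_of_le_of_lt (Nat.zero_le _) a.isLt)⟩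

/-- A word: a finite sequence of letters with no adjacent letter equal to the bar of the
previous one. -/
def IsWord {r : ℕ} (w : List (Fin (2 * r))) : Prop :=
  w.Chain' (fun x y => x ≠ wordBar y)

/-- The mirror word `𝐚̄ = (ā_n, …, ā_1)`. -/
def mirror {r : ℕ} (w : List (Fin (2 * r))) : List (Fin (2 * r)) :=
  (w.map wordBar).reverse

/-- `𝐚 → 𝐛` : either word is empty, or the last letter of `𝐚` is not the bar of the first
letter of `𝐛`. -/
def arrow {r : ℕ} (w v : List (Fin (2 * r))) : Prop :=
  ∀ x ∈ w.getLast?, ∀ y ∈ v.head?, x ≠ wordBar y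

/-- `𝐚 ⇝ 𝐛` : both words are nonempty and the last letter of `𝐚` equals the first letter
of `𝐛`. -/
def wiggly {r : ℕ} (w v : List (Fin (2 * r))) : Prop :=
  w ≠ [] ∧ v ≠ [] ∧ w.getLast? = v.head?

/-- Schottky data: pairwise disjoint closed discs centered on the real line, paired by
elements of `SL(2,ℝ)`. -/
structure Schottky where
  r : ℕ
  two_le_r : 2 ≤ r
  center : Fin (2 * r) → ℝ
  radius : Fin (2 * r) → ℝ
  radius_pos : ∀ a, 0 < radius a
  g : Fin (2 * r) → SL2
  disjoint : ∀ a b : Fin (2 * r), a ≠ b →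
    Disjoint (closure (Metric.ball ((center a : ℂ)) (radius a)))
             (closure (Metric.ball ((center b : ℂ)) (radius b)))
  g_bar : ∀ a : Fin (2 * r), g (wordBar a) = (g a)⁻¹
  maps : ∀ a : Fin (2 * r),
    mobiusS (g a) '' (((fun w : ℂ => (w : OnePoint ℂ)) ''
        Metric.ball ((center (wordBar a) : ℂ)) (radius (wordBar a)))ᶜ)
      = (fun w : ℂ => (w : OnePoint ℂ)) '' closure (Metric.ball ((center a : ℂ)) (radius a))

namespace Schottky

variable (S : Schottky)

/-- The open disc `D_a`. -/
def D (a : Fin (2 * S.r)) : Set ℂ := Metric.ball ((S.center a : ℂ)) (S.radius a)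

/-- The union `𝐃` of the open discs. -/
def Dall : Set ℂ := ⋃ a, S.D a

/-- The open interval `I_a = D_a ∩ ℝ`. -/
def Ireal (a : Fin (2 * S.r)) : Set ℝ := {x : ℝ | (x : ℂ) ∈ S.D a}

/-- The union `I` of the intervals `I_a`. -/
def Iall : Set ℝ := ⋃ a, S.Ireal a

/-- The group element `γ_𝐚 = γ_{a₁} ⋯ γ_{a_n}` associated to a word. -/
noncomputable def wprod (w : List (Fin (2 * S.r))) : SL2 := (w.map S.g).prod

/-- The Schottky group `Γ`, generated by the `γ_a`. -/
def SGroup : Subgroup SL2 := Subgroup.closure (Set.range S.g)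

theorem wprod_mem (w : List (Fin (2 * S.r))) : S.wprod w ∈ S.SGroup := by
  apply Subgroup.list_prod_mem
  intro x hx
  obtain ⟨a, -, rfl⟩ := List.mem_map.mp hx
  exact Subgroup.subset_closure ⟨a, rfl⟩

/-- `γ_𝐚` as an element of the Schottky group `Γ`. -/
noncomputable def wprodG (w : List (Fin (2 * S.r))) : S.SGroup := ⟨S.wprod w, S.wprod_mem w⟩

/-- The generator `γ_a` as an element of `Γ`. -/
noncomputable def genG (a : Fin (2 * S.r)) : S.SGroup :=
  ⟨S.g a, Subgroup.subset_closure ⟨a, rfl⟩⟩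

/-- The interval `I_𝐚 = γ_{𝐚'}(I_{a_n})` of a nonempty word. -/
noncomputable def Iset (w : List (Fin (2 * S.r))) : Set ℝ :=
  if h : w = [] then ∅ else mobiusR (S.wprod w.dropLast) '' S.Ireal (w.getLast h)

/-- `Υ_𝐚 = |I_𝐚|`, the length of the interval `I_𝐚`; `Υ_∅ = 1`. -/
noncomputable def ups (w : List (Fin (2 * S.r))) : ℝ :=
  if w = [] then 1 else (volume (S.Iset w)).toReal

/-- The Bourgain–Dyatlov partition `Z(τ)`. -/
def Zset (τ : ℝ) : Set (List (Fin (2 * S.r))) :=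
  {w | IsWord w ∧ w ≠ [] ∧ S.ups w ≤ τ ∧ τ < S.ups w.dropLast}

/-- The mirror set `Z̄(τ) = {𝐚 ∈ 𝒲 : 𝐚̄ ∈ Z(τ)}`. -/
def Zbar (τ : ℝ) : Set (List (Fin (2 * S.r))) :=
  {w | IsWord w ∧ mirror w ∈ S.Zset τ}

open Classical in
/-- The Bowen–Series map on the Riemann sphere (junk value `∞` off `𝐃`). -/
noncomputable def TS (z : OnePoint ℂ) : OnePoint ℂ :=
  if h : ∃ a : Fin (2 * S.r), ∃ w : ℂ, z = (w : OnePoint ℂ) ∧ w ∈ S.D a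
  then mobiusS (S.g h.choose)⁻¹ z
  else OnePoint.infty

/-- The limit set `Λ`: points of `𝐃` all of whose forward iterates under the Bowen–Series
map are defined (finite) and remain in `𝐃`. -/
def limitSet : Set ℂ :=
  {z : ℂ | ∀ n : ℕ, ∃ w : ℂ, (S.TS)^[n] (z : OnePoint ℂ) = (w : OnePoint ℂ) ∧ w ∈ S.Dall}

/-- The limit set, viewed inside `ℝ`. -/
def limitSetR : Set ℝ := {x : ℝ | (x : ℂ) ∈ S.limitSet}

/-- `δ`, the Hausdorff dimension of the limit set. -/
noncomputable def delta : ℝ := (dimH S.limitSet).toReal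

/-- `PowerPairs(τ)`: pairs `(𝐚,𝐛) ∈ Z̄(τ)²` such that `γ_{𝐚'}γ_{𝐛'}⁻¹` is a nontrivial
proper power in `Γ`. -/
def PowerPairs (τ : ℝ) : Set (List (Fin (2 * S.r)) × List (Fin (2 * S.r))) :=
  {p | p.1 ∈ S.Zbar τ ∧ p.2 ∈ S.Zbar τ ∧
    S.wprod p.1.dropLast * (S.wprod p.2.dropLast)⁻¹ ≠ 1 ∧
    ∃ γ₀ ∈ S.SGroup, ∃ q : ℕ, 2 ≤ q ∧
      S.wprod p.1.dropLast * (S.wprod p.2.dropLast)⁻¹ = (γ₀ : SL2) ^ q}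

end Schottky

/-- The permutation `π_a` associated to a letter `a ∈ 𝒜`: `π_a = σ_a` for the first `r`
letters and `π_a = σ_{a−r}⁻¹` for the last `r` letters. -/
noncomputable def sigmaPerm {r n : ℕ} (σ : Fin r → Equiv.Perm (Fin n))
    (a : Fin (2 * r)) : Equiv.Perm (Fin n) :=
  if h : a.1 < r then σ ⟨a.1, h⟩ else (σ ⟨a.1 - r, by have := a.2; omega⟩)⁻¹

/-- `Π(𝐜) = π_{c₁} π_{c₂} ⋯ π_{c_m}`. -/
noncomputable def wordPerm {r n : ℕ} (σ : Fin r → Equiv.Perm (Fin n))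
    (w : List (Fin (2 * r))) : Equiv.Perm (Fin n) :=
  (w.map (sigmaPerm σ)).prod

/-- The number of fixed points of a permutation. -/
def fixCount {n : ℕ} (π : Equiv.Perm (Fin n)) : ℕ :=
  (Finset.univ.filter fun i : Fin n => π i = i).card

open scoped BigOperators

section Cantor

variable {M : ℕ}

/-- Composition `φ_{s₀} ∘ ⋯ ∘ φ_{s_{k-1}}` of the maps of an iterated function system. -/
def ifsIter (φ : Fin M → ℝ → ℝ) (s : ℕ → Fin M) : ℕ → ℝ → ℝ
  | 0 => id
  | k + 1 => ifsIter φ s k ∘ φ (s k)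

theorem ifsIter_congr (φ : Fin M → ℝ → ℝ) {s t : ℕ → Fin M} {k : ℕ} (h : ∀ i < k, s i = t i) :
    ifsIter φ s k = ifsIter φ t k := by
  induction k with
  | zero => rfl
  | succ k ih => rw [ifsIter, ifsIter, ih fun i hi => h i (by omega), h k (by omega)]

theorem ifsIter_expanding {φ : Fin M → ℝ → ℝ} {J : Set ℝ} {ρ : ℝ} (hρ : 0 < ρ)
    (hmaps : ∀ i, Set.MapsTo (φ i) J J)
    (hexp : ∀ i, ∀ x ∈ J, ∀ y ∈ J, ρ * |x - y| ≤ |φ i x - φ i y|) (s : ℕ → Fin M) (k : ℕ) :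
    ∀ x ∈ J, ∀ y ∈ J, ρ ^ k * |x - y| ≤ |ifsIter φ s k x - ifsIter φ s k y| := by
  induction k with
  | zero => intro x _ y _; simp [ifsIter]
  | succ k ih =>
    intro x hx y hy
    calc ρ ^ (k + 1) * |x - y| = ρ ^ k * (ρ * |x - y|) := by ring
      _ ≤ ρ ^ k * |φ (s k) x - φ (s k) y| := by
        gcongr; exact hexp _ x hx y hy
      _ ≤ _ := ih _ (hmaps _ hx) _ (hmaps _ hy)

theorem continuousOn_ifsIter {φ : Fin M → ℝ → ℝ} {J : Set ℝ}
    (hmaps : ∀ i, Set.MapsTo (φ i) J J) (hcont : ∀ i, ContinuousOn (φ i) J)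
    (s : ℕ → Fin M) (k : ℕ) : ContinuousOn (ifsIter φ s k) J := by
  induction k with
  | zero => exact continuousOn_id
  | succ k ih => exact ih.comp (hcont _) (hmaps _)

theorem exists_coding {φ : Fin M → ℝ → ℝ} {J : Set ℝ} (hJ : IsCompact J) (hne : J.Nonempty)
    (hmaps : ∀ i, Set.MapsTo (φ i) J J) (hcont : ∀ i, ContinuousOn (φ i) J) (s : ℕ → Fin M) :
    ∃ x, ∀ k, x ∈ ifsIter φ s k '' J := by
  have hc : ∀ k, IsCompact (ifsIter φ s k '' J) := fun k =>
    hJ.image_of_continuousOn (continuousOn_ifsIter hmaps hcont s k)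
  have := IsCompact.nonempty_iInter_of_sequence_nonempty_isCompact_isClosed
    (fun k => ifsIter φ s k '' J)
    (fun k => by
      rw [ifsIter, Set.image_comp]
      exact Set.image_mono (hmaps _).image_subset)
    (fun k => hne.image _) (hc 0) (fun k => (hc k).isClosed)
  obtain ⟨x, hx⟩ := this
  exact ⟨x, fun k => Set.mem_iInter.mp hx k⟩

theorem exists_uniform_gap {φ : Fin M → ℝ → ℝ} {J : Set ℝ} (hJ : IsCompact J)
    (hcont : ∀ i, ContinuousOn (φ i) J)
    (hdisj : ∀ i j, i ≠ j → Disjoint (φ i '' J) (φ j '' J)) :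
    ∃ g : ℝ, 0 < g ∧ ∀ i j, i ≠ j → ∀ x ∈ φ i '' J, ∀ y ∈ φ j '' J, g ≤ |x - y| := by
  have hc : ∀ i, IsCompact (φ i '' J) := fun i => hJ.image_of_continuousOn (hcont i)
  have key : ∀ᶠ g : ℝ in nhdsWithin 0 (Set.Ioi 0), ∀ i j, i ≠ j →
      ∀ x ∈ φ i '' J, ∀ y ∈ φ j '' J, g ≤ |x - y| := by
    refine Filter.eventually_all.2 fun i => Filter.eventually_all.2 fun j => ?_
    by_cases hij : i = j
    · simp [hij]
    obtain ⟨δ, hδ, h⟩ := (hdisj i j hij).exists_thickenings (hc i) (hc j).isClosed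
    filter_upwards [Ioo_mem_nhdsGT hδ] with g hg _ x hx y hy
    by_contra hlt
    push Not at hlt
    refine Set.disjoint_left.1 h (?_ : y ∈ _) (Metric.self_subset_thickening hδ _ hy)
    refine Metric.mem_thickening_iff.2 ⟨x, hx, ?_⟩
    rw [dist_comm, Real.dist_eq]
    exact hlt.trans hg.2
  obtain ⟨g, hg, hg0⟩ := (key.and self_mem_nhdsWithin).exists
  exact ⟨g, hg0, hg⟩

/-- Lower bound for the dimension of the attractor of a separated iterated function system whose
maps contract by at most `ρ`. -/
theorem card_le_rpow_of_ifs {φ : Fin M → ℝ → ℝ} {J : Set ℝ} {ρ : ℝ} (hM : 1 < M)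
    (hρ : 0 < ρ) (hρ1 : ρ < 1) (hJ : IsCompact J) (hne : J.Nonempty)
    (hmaps : ∀ i, Set.MapsTo (φ i) J J) (hcont : ∀ i, ContinuousOn (φ i) J)
    (hexp : ∀ i, ∀ x ∈ J, ∀ y ∈ J, ρ * |x - y| ≤ |φ i x - φ i y|)
    (hdisj : ∀ i j, i ≠ j → Disjoint (φ i '' J) (φ j '' J)) {Λ : Set ℝ}
    (hΛ : ∀ x, (∃ s : ℕ → Fin M, ∀ k, x ∈ ifsIter φ s k '' J) → x ∈ Λ) :
    (M : ℝ) ≤ ρ ^ (-(dimH Λ).toReal) := by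
  have hM0 : (0 : ℝ) < M := by positivity
  have hM1 : (1 : ℝ) < M := by exact_mod_cast hM
  choose X hX using exists_coding hJ hne hmaps hcont
  obtain ⟨g, hg, hgap⟩ := exists_uniform_gap hJ hcont hdisj
  set θ : ℝ := Real.log M / (-Real.log ρ) with hθ
  have hlogρ : 0 < -Real.log ρ := by linarith [Real.log_neg hρ hρ1]
  have hθ0 : 0 < θ := div_pos (Real.log_pos hM1) hlogρ
  have hρθ : ρ ^ θ = (M : ℝ)⁻¹ := by
    rw [Real.rpow_def_of_pos hρ, hθ, ← Real.exp_log (inv_pos.2 hM0), Real.log_inv]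
    congr 1
    have := (neg_pos.1 hlogρ).ne
    field_simp
  have hsep : ∀ s t : ℕ → Fin M, |Real.ofDigits s - Real.ofDigits t| ≤
      g ^ (-θ) * |X s - X t| ^ θ := by
    intro s t
    by_cases hst : s = t
    · subst hst; simp [Real.zero_rpow hθ0.ne']
    have hex : ∃ k, s k ≠ t k := by
      by_contra h; push Not at h; exact hst (funext h)
    classical
    set k := Nat.find hex with hk
    have hkne : s k ≠ t k := Nat.find_spec hex
    have hklt : ∀ i < k, s i = t i := fun i hi => by
      by_contra h; exact Nat.find_min hex hi h
    have h1 : |Real.ofDigits s - Real.ofDigits t| ≤ ((M : ℝ)⁻¹) ^ k := by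
      have := Real.abs_ofDigits_sub_ofDigits_le (n := k) hklt
      simpa [inv_pow] using this
    obtain ⟨u, hu, hsu⟩ := hX s (k + 1)
    obtain ⟨v, hv, htv⟩ := hX t (k + 1)
    have h2 : ρ ^ k * g ≤ |X s - X t| := by
      rw [← hsu, ← htv, ifsIter, ifsIter, ← ifsIter_congr φ hklt]
      refine le_trans ?_ (ifsIter_expanding hρ hmaps hexp s k _ (hmaps _ hu) _ (hmaps _ hv))
      gcongr
      exact hgap _ _ hkne _ ⟨u, hu, rfl⟩ _ ⟨v, hv, rfl⟩
    have h3 : (ρ ^ k * g) ^ θ ≤ |X s - X t| ^ θ :=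
      Real.rpow_le_rpow (by positivity) h2 hθ0.le
    have h4 : (ρ ^ k * g) ^ θ = ((M : ℝ)⁻¹) ^ k * g ^ θ := by
      rw [Real.mul_rpow (by positivity) hg.le, ← Real.rpow_natCast, ← Real.rpow_mul hρ.le,
        mul_comm (k : ℝ), Real.rpow_mul hρ.le, hρθ, Real.rpow_natCast]
    calc _ ≤ ((M : ℝ)⁻¹) ^ k := h1
      _ = g ^ (-θ) * ((ρ ^ k * g) ^ θ) := by
        rw [h4, Real.rpow_neg hg.le]
        have : g ^ θ ≠ 0 := (Real.rpow_pos_of_pos hg θ).ne'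
        field_simp
      _ ≤ _ := by gcongr
  have : Nonempty (ℕ → Fin M) := ⟨fun _ => ⟨0, by omega⟩⟩
  let F : ℝ → ℝ := fun x => Real.ofDigits (Function.invFun X x)
  have hF : ∀ s, F (X s) = Real.ofDigits s := by
    intro s
    have h1 : X (Function.invFun X (X s)) = X s := Function.invFun_eq ⟨s, rfl⟩
    have h2 := hsep (Function.invFun X (X s)) s
    rw [h1, sub_self, abs_zero, Real.zero_rpow hθ0.ne', mul_zero] at h2
    exact sub_eq_zero.1 (abs_nonpos_iff.1 h2)
  have hgθ : 0 ≤ g ^ (-θ) := by positivity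
  obtain ⟨c, hc⟩ : ∃ c : NNReal, (c : ℝ) = g ^ (-θ) := ⟨_, Real.coe_toNNReal _ hgθ⟩
  obtain ⟨t, ht⟩ : ∃ t : NNReal, (t : ℝ) = θ := ⟨_, Real.coe_toNNReal _ hθ0.le⟩
  have ht0 : 0 < t := by exact_mod_cast ht ▸ hθ0
  have hhol : HolderOnWith c t F (Set.range X) := by
    rintro _ ⟨s, rfl⟩ _ ⟨s', rfl⟩
    rw [ht, hF, hF, edist_dist, edist_dist, Real.dist_eq, Real.dist_eq]
    rw [ENNReal.ofReal_rpow_of_nonneg (abs_nonneg _) hθ0.le, ← ENNReal.ofReal_coe_nnreal,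
      ← ENNReal.ofReal_mul (by positivity), hc]
    exact ENNReal.ofReal_le_ofReal (hsep s s')
  have hdim := hhol.dimH_image_le ht0
  have hsub : Set.Icc (0 : ℝ) 1 ⊆ F '' Set.range X := by
    intro y hy
    obtain ⟨s, -, rfl⟩ := Real.ofDigits_SurjOn hM hy
    exact ⟨X s, ⟨s, rfl⟩, hF s⟩
  have h1 : (1 : ENNReal) ≤ dimH (F '' Set.range X) := by
    calc (1 : ENNReal) = dimH (Set.Icc (0 : ℝ) 1) := by
          rw [Real.dimH_of_nonempty_interior (by rw [interior_Icc]; exact ⟨1 / 2, by norm_num⟩)]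
          simp
      _ ≤ _ := dimH_mono hsub
  have h2 : ENNReal.ofReal θ ≤ dimH Λ := by
    have h3 := h1.trans hdim
    have h4 : dimH (Set.range X) ≤ dimH Λ := dimH_mono (by
      rintro _ ⟨s, rfl⟩; exact hΛ _ ⟨s, hX s⟩)
    refine le_trans ?_ h4
    rw [← ht, ENNReal.ofReal_coe_nnreal]
    rw [ENNReal.le_div_iff_mul_le (Or.inl (by simpa using ht0.ne')) (Or.inl ENNReal.coe_ne_top)]
      at h3
    simpa using h3
  have h3 : θ ≤ (dimH Λ).toReal :=
    (ENNReal.ofReal_le_iff_le_toReal (Real.dimH_ne_top Λ)).1 h2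
  calc (M : ℝ) = ρ ^ (-θ) := by rw [Real.rpow_neg hρ.le, hρθ, inv_inv]
    _ ≤ _ := Real.rpow_le_rpow_of_exponent_ge hρ hρ1.le (by linarith)

end Cantor

section RandomPermutations

variable {r n : ℕ}

theorem wordBar_wordBar (a : Fin (2 * r)) : wordBar (wordBar a) = a := by
  ext
  simp only [wordBar]
  have := a.2
  by_cases h : a.1 < r
  · rw [Nat.mod_eq_of_lt (a := a.1 + r) (by omega), Nat.mod_eq_sub_mod (by omega),
      Nat.mod_eq_of_lt (by omega)]
    omega
  · rw [Nat.mod_eq_sub_mod (a := a.1 + r) (by omega), Nat.mod_eq_of_lt (a := a.1 + r - 2 * r)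
      (by omega), Nat.mod_eq_of_lt (by omega)]
    omega

theorem wordBar_val_of_lt {a : Fin (2 * r)} (h : a.1 < r) : (wordBar a).1 = a.1 + r := by
  simp only [wordBar]
  exact Nat.mod_eq_of_lt (by omega)

theorem wordBar_val_of_le {a : Fin (2 * r)} (h : r ≤ a.1) : (wordBar a).1 = a.1 - r := by
  have := a.2
  simp only [wordBar]
  rw [Nat.mod_eq_sub_mod (by omega), Nat.mod_eq_of_lt (by omega)]
  omega

theorem wordBar_ne (a : Fin (2 * r)) : wordBar a ≠ a := by
  intro h
  have h1 := congrArg Fin.val h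
  have := a.2
  by_cases ha : a.1 < r
  · rw [wordBar_val_of_lt ha] at h1; omega
  · rw [wordBar_val_of_le (by omega)] at h1; omega

theorem sigmaPerm_wordBar (σ : Fin r → Equiv.Perm (Fin n)) (a : Fin (2 * r)) :
    sigmaPerm σ (wordBar a) = (sigmaPerm σ a)⁻¹ := by
  by_cases ha : a.1 < r
  · have h1 := wordBar_val_of_lt ha
    rw [sigmaPerm, sigmaPerm, dif_neg (by omega), dif_pos ha]
    congr 2
    ext; simp [h1]
  · have h1 := wordBar_val_of_le (a := a) (by omega)
    have := a.2
    rw [sigmaPerm, sigmaPerm, dif_pos (by omega), dif_neg ha, inv_inv]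
    congr 1
    ext; simp [h1]

/-- Replace the permutation attached to the letter `a` by its product with `τ` on the left. -/
noncomputable def twistPerm (σ : Fin r → Equiv.Perm (Fin n)) (a : Fin (2 * r))
    (τ : Equiv.Perm (Fin n)) : Fin r → Equiv.Perm (Fin n) :=
  if h : a.1 < r then Function.update σ ⟨a.1, h⟩ (τ * σ ⟨a.1, h⟩)
  else Function.update σ ⟨a.1 - r, by have := a.2; omega⟩
    (σ ⟨a.1 - r, by have := a.2; omega⟩ * τ⁻¹)

theorem sigmaPerm_twistPerm_self (σ : Fin r → Equiv.Perm (Fin n)) (a : Fin (2 * r))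
    (τ : Equiv.Perm (Fin n)) : sigmaPerm (twistPerm σ a τ) a = τ * sigmaPerm σ a := by
  by_cases ha : a.1 < r
  · simp [sigmaPerm, twistPerm, ha]
  · simp [sigmaPerm, twistPerm, ha]

theorem sigmaPerm_twistPerm_of_ne (σ : Fin r → Equiv.Perm (Fin n)) {a b : Fin (2 * r)}
    (τ : Equiv.Perm (Fin n)) (h1 : b ≠ a) (h2 : b ≠ wordBar a) :
    sigmaPerm (twistPerm σ a τ) b = sigmaPerm σ b := by
  have h1' : b.1 ≠ a.1 := fun h => h1 (Fin.ext h)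
  have h2' : b.1 ≠ (wordBar a).1 := fun h => h2 (Fin.ext h)
  have := a.2
  have := b.2
  by_cases ha : a.1 < r <;> by_cases hb : b.1 < r
  · rw [sigmaPerm, sigmaPerm, dif_pos hb, dif_pos hb, twistPerm, dif_pos ha,
      Function.update_of_ne]
    intro h
    have := congrArg Fin.val h
    simp only at this
    exact h1' this
  · rw [wordBar_val_of_lt ha] at h2'
    rw [sigmaPerm, sigmaPerm, dif_neg hb, dif_neg hb, twistPerm, dif_pos ha,
      Function.update_of_ne]
    intro h
    have := congrArg Fin.val h
    simp only at this
    omega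
  · rw [wordBar_val_of_le (by omega)] at h2'
    rw [sigmaPerm, sigmaPerm, dif_pos hb, dif_pos hb, twistPerm, dif_neg ha,
      Function.update_of_ne]
    intro h
    have := congrArg Fin.val h
    simp only at this
    omega
  · rw [sigmaPerm, sigmaPerm, dif_neg hb, dif_neg hb, twistPerm, dif_neg ha,
      Function.update_of_ne]
    intro h
    have := congrArg Fin.val h
    simp only at this
    omega

theorem twistPerm_twistPerm (σ : Fin r → Equiv.Perm (Fin n)) (a : Fin (2 * r))
    (τ τ' : Equiv.Perm (Fin n)) : twistPerm (twistPerm σ a τ) a τ' = twistPerm σ a (τ' * τ) := by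
  by_cases ha : a.1 < r
  · simp [twistPerm, ha, mul_assoc]
  · simp [twistPerm, ha, mul_assoc]

theorem twistPerm_one (σ : Fin r → Equiv.Perm (Fin n)) (a : Fin (2 * r)) :
    twistPerm σ a 1 = σ := by
  by_cases ha : a.1 < r
  · simp [twistPerm, ha]
  · simp [twistPerm, ha]

/-- The trajectory of a point under the successive letters of an infinite sequence. -/
noncomputable def walk (σ : Fin r → Equiv.Perm (Fin n)) (w : ℕ → Fin (2 * r)) (i : Fin n) :
    ℕ → Fin n
  | 0 => i
  | k + 1 => sigmaPerm σ (w k) (walk σ w i k)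

/-- The values of the `k`-th permutation already revealed by the first `k` steps of a trajectory. -/
def revealed (w : ℕ → Fin (2 * r)) (p : ℕ → Fin n) (k : ℕ) : Set (Fin n) :=
  {z | ∃ m < k, (w m = w k ∧ p (m + 1) = z) ∨ (w m = wordBar (w k) ∧ p m = z)}

theorem revealed_congr {w : ℕ → Fin (2 * r)} {p q : ℕ → Fin n} {k : ℕ}
    (h : ∀ m ≤ k, p m = q m) : revealed w p k = revealed w q k := by
  ext z
  simp only [revealed, Set.mem_ofPred_eq]
  refine exists_congr fun m => and_congr_right fun hm => ?_
  rw [h m (by omega), h (m + 1) (by omega)]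

theorem revealed_subset (w : ℕ → Fin (2 * r)) (p : ℕ → Fin n) (k : ℕ) :
    revealed w p k ⊆ ((Finset.range (k + 1)).image p : Finset (Fin n)) := by
  rintro z ⟨m, hm, ⟨-, rfl⟩ | ⟨-, rfl⟩⟩
  · exact Finset.mem_coe.2 (Finset.mem_image_of_mem _ (Finset.mem_range.2 (by omega)))
  · exact Finset.mem_coe.2 (Finset.mem_image_of_mem _ (Finset.mem_range.2 (by omega)))

theorem walk_bar {σ : Fin r → Equiv.Perm (Fin n)} {w : ℕ → Fin (2 * r)} {i : Fin n} {m k : ℕ}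
    (h : w m = wordBar (w k)) (hp : walk σ w i m = walk σ w i (k + 1)) :
    walk σ w i (m + 1) = walk σ w i k := by
  simp only [walk] at hp ⊢
  rw [h, hp, sigmaPerm_wordBar]
  simp

theorem walk_twist {σ : Fin r → Equiv.Perm (Fin n)} {w : ℕ → Fin (2 * r)} {i : Fin n} {k : ℕ}
    {z : Fin n} (h : walk σ w i (k + 1) ∉ revealed w (walk σ w i) k)
    (hz : z ∉ revealed w (walk σ w i) k) :
    (∀ m ≤ k, walk (twistPerm σ (w k) (Equiv.swap (walk σ w i (k + 1)) z)) w i m = walk σ w i m) ∧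
    walk (twistPerm σ (w k) (Equiv.swap (walk σ w i (k + 1)) z)) w i (k + 1) = z := by
  set σ' := twistPerm σ (w k) (Equiv.swap (walk σ w i (k + 1)) z) with hσ'
  have hne : ∀ x ∈ revealed w (walk σ w i) k,
      Equiv.swap (walk σ w i (k + 1)) z x = x := fun x hx =>
    Equiv.swap_apply_of_ne_of_ne (fun e => h (e ▸ hx)) (fun e => hz (e ▸ hx))
  have h1 : ∀ m ≤ k, walk σ' w i m = walk σ w i m := by
    intro m
    induction m with
    | zero => intro _; rfl
    | succ m ih =>
      intro hm
      show sigmaPerm σ' (w m) (walk σ' w i m) = walk σ w i (m + 1)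
      rw [ih (by omega)]
      by_cases ha : w m = w k
      · rw [ha, hσ', sigmaPerm_twistPerm_self, Equiv.Perm.mul_apply, ← ha]
        exact hne _ ⟨m, by omega, Or.inl ⟨ha, rfl⟩⟩
      by_cases hb : w m = wordBar (w k)
      · rw [hb, hσ', sigmaPerm_wordBar, sigmaPerm_twistPerm_self, mul_inv_rev,
          Equiv.Perm.mul_apply, Equiv.swap_inv, hne _ ⟨m, by omega, Or.inr ⟨hb, rfl⟩⟩,
          ← sigmaPerm_wordBar, ← hb]
        rfl
      · rw [hσ', sigmaPerm_twistPerm_of_ne _ _ ha hb]; rfl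
  refine ⟨h1, ?_⟩
  show sigmaPerm σ' (w k) (walk σ' w i k) = z
  rw [h1 k le_rfl, hσ', sigmaPerm_twistPerm_self, Equiv.Perm.mul_apply]
  exact Equiv.swap_apply_left _ _

/-- Step `k` of the trajectory `p` reveals a new value and returns to the point visited at time
`j`. -/
def coincidence (w : ℕ → Fin (2 * r)) (p : ℕ → Fin n) (k j : ℕ) : Prop :=
  p (k + 1) ∉ revealed w p k ∧ p (k + 1) = p j

open Classical in
theorem card_coincidence_mul_le (w : ℕ → Fin (2 * r)) (i : Fin n) {k j : ℕ} (hj : j ≤ k)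
    (Q : (Fin r → Equiv.Perm (Fin n)) → Prop)
    (hQ : ∀ σ σ', (∀ m ≤ k, walk σ' w i m = walk σ w i m) → Q σ → Q σ') :
    (Finset.univ.filter fun σ => Q σ ∧ coincidence w (walk σ w i) k j).card * (n - (k + 1)) ≤
      (Finset.univ.filter Q).card := by
  set A := Finset.univ.filter fun σ => Q σ ∧ coincidence w (walk σ w i) k j with hA
  let B := A.sigma fun σ => Finset.univ.filter fun z => z ∉ revealed w (walk σ w i) k
  have hcard : A.card * (n - (k + 1)) ≤ B.card := by
    rw [Finset.card_sigma, ← smul_eq_mul]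
    refine Finset.card_nsmul_le_sum _ _ _ fun σ _ => ?_
    have h1 : (Finset.univ \ (Finset.range (k + 1)).image (walk σ w i)) ⊆
        Finset.univ.filter fun z => z ∉ revealed w (walk σ w i) k := by
      intro z hz
      simp only [Finset.mem_sdiff, Finset.mem_univ, true_and] at hz
      simp only [Finset.mem_filter, Finset.mem_univ, true_and]
      exact fun h => hz (Finset.mem_coe.1 (revealed_subset w _ k h))
    refine le_trans ?_ (Finset.card_le_card h1)
    rw [Finset.card_sdiff_of_subset (Finset.subset_univ _), Finset.card_univ, Fintype.card_fin]
    have : ((Finset.range (k + 1)).image (walk σ w i)).card ≤ k + 1 := by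
      simpa using Finset.card_image_le (s := Finset.range (k + 1)) (f := walk σ w i)
    omega
  refine hcard.trans (Finset.card_le_card_of_injOn
    (fun x => twistPerm x.1 (w k) (Equiv.swap (walk x.1 w i (k + 1)) x.2)) ?_ ?_)
  · rintro ⟨σ, z⟩ hx
    simp only [B, A, Finset.coe_sigma, Set.mem_sigma_iff, Finset.mem_coe, Finset.mem_filter,
      Finset.mem_univ, true_and] at hx ⊢
    exact hQ σ _ (walk_twist hx.1.2.1 hx.2).1 hx.1.1
  · rintro ⟨σ, z⟩ hx ⟨σ', z'⟩ hx' heq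
    simp only [B, A, Finset.coe_sigma, Set.mem_sigma_iff, Finset.mem_coe, Finset.mem_filter,
      Finset.mem_univ, true_and] at hx hx' heq
    have h1 := walk_twist hx.1.2.1 hx.2
    have h2 := walk_twist hx'.1.2.1 hx'.2
    have hz : z = z' := by rw [← h1.2, ← h2.2, heq]
    have hp : walk σ w i (k + 1) = walk σ' w i (k + 1) := by
      rw [hx.1.2.2, hx'.1.2.2, ← h1.1 j hj, ← h2.1 j hj, heq]
    have hσ : σ = σ' := by
      have := congrArg (fun s => twistPerm s (w k) (Equiv.swap (walk σ w i (k + 1)) z)) heq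
      rw [← hz, ← hp, twistPerm_twistPerm, twistPerm_twistPerm, Equiv.swap_mul_self,
        twistPerm_one, twistPerm_one] at this
      exact this
    subst hσ; subst hz; rfl

end RandomPermutations

section RandomWords

variable {r n : ℕ}

theorem walk_add (σ : Fin r → Equiv.Perm (Fin n)) (w : ℕ → Fin (2 * r)) (i : Fin n) (s m : ℕ) :
    walk σ w i (s + m) = walk σ (fun j => w (s + j)) (walk σ w i s) m := by
  induction m with
  | zero => rfl
  | succ m ih => rw [← add_assoc, walk, walk, ih]

theorem walk_injective (σ : Fin r → Equiv.Perm (Fin n)) (w : ℕ → Fin (2 * r)) (s : ℕ) :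
    Function.Injective fun i => walk σ w i s := by
  induction s with
  | zero => exact fun _ _ h => h
  | succ s ih => exact fun _ _ h => ih ((sigmaPerm σ (w s)).injective h)

theorem notMem_revealed_of_new {σ : Fin r → Equiv.Perm (Fin n)} {w : ℕ → Fin (2 * r)} {i : Fin n}
    (hw : ∀ m, w m ≠ wordBar (w (m + 1))) {k : ℕ} (h : ∀ m < k, walk σ w i m ≠ walk σ w i k) :
    walk σ w i (k + 1) ∉ revealed w (walk σ w i) k := by
  rintro ⟨m, hm, ⟨h1, h2⟩ | ⟨h1, h2⟩⟩
  · simp only [walk] at h2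
    rw [h1] at h2
    exact h m hm ((sigmaPerm σ (w k)).injective h2)
  · have h3 := walk_bar h1 h2
    rcases Nat.lt_or_ge (m + 1) k with h4 | h4
    · exact h _ h4 h3
    · obtain rfl : k = m + 1 := by omega
      exact hw m h1

theorem walk_mod {σ : Fin r → Equiv.Perm (Fin n)} {w : ℕ → Fin (2 * r)} {i : Fin n} {c t : ℕ}
    (hc : 0 < c) (h0 : walk σ w i c = walk σ w i 0)
    (hper : ∀ m, c ≤ m → m < t → w m = w (m - c)) :
    (∀ m < t, w m = w (m % c)) ∧ ∀ m ≤ t, walk σ w i m = walk σ w i (m % c) := by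
  have h1 : ∀ m, c ≤ m → m ≤ t → walk σ w i m = walk σ w i (m - c) := by
    intro m hm
    induction m, hm using Nat.le_induction with
    | base => intro _; rw [h0, Nat.sub_self]
    | succ m hm ih =>
      intro h
      rw [Nat.sub_add_comm hm, walk, walk, ih (by omega), hper m hm (by omega)]
  constructor
  · intro m
    induction m using Nat.strong_induction_on with
    | _ m ih =>
      intro hm
      rcases Nat.lt_or_ge m c with h | h
      · rw [Nat.mod_eq_of_lt h]
      · rw [hper m h hm, ih (m - c) (by omega) (by omega), Nat.mod_eq_sub_mod h]
  · intro m
    induction m using Nat.strong_induction_on with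
    | _ m ih =>
      intro hm
      rcases Nat.lt_or_ge m c with h | h
      · rw [Nat.mod_eq_of_lt h]
      · rw [h1 m h hm, ih (m - c) (by omega) (by omega), Nat.mod_eq_sub_mod h]

/-- A trajectory which follows a simple cycle and then leaves it reveals a new value. -/
theorem notMem_revealed_of_leave {σ : Fin r → Equiv.Perm (Fin n)} {w : ℕ → Fin (2 * r)}
    {i : Fin n} (hw : ∀ m, w m ≠ wordBar (w (m + 1))) {c t : ℕ} (hc : 0 < c) (hct : c ≤ t)
    (h0 : walk σ w i c = walk σ w i 0)
    (hdist : ∀ a < c, ∀ b < c, walk σ w i a = walk σ w i b → a = b)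
    (hper : ∀ m, c ≤ m → m < t → w m = w (m - c)) (ht : w t ≠ w (t - c)) :
    walk σ w i (t + 1) ∉ revealed w (walk σ w i) t := by
  obtain ⟨hwm, hpm⟩ := walk_mod hc h0 hper
  have hmod : ∀ m ≤ t, walk σ w i m = walk σ w i t → m % c = t % c := by
    intro m hm h
    rw [hpm m hm, hpm t le_rfl] at h
    exact hdist _ (Nat.mod_lt _ hc) _ (Nat.mod_lt _ hc) h
  rintro ⟨m, hm, ⟨h1, h2⟩ | ⟨h1, h2⟩⟩
  · simp only [walk] at h2
    rw [h1] at h2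
    have h3 := hmod m hm.le ((sigmaPerm σ (w t)).injective h2)
    apply ht
    rw [← h1, hwm m hm, h3, hwm (t - c) (by omega), ← Nat.mod_eq_sub_mod hct]
  · have h3 := hmod (m + 1) (by omega) (walk_bar h1 h2)
    have h4 : m % c = (t - 1) % c := by
      have : (m + 1) ≡ (t - 1) + 1 [MOD c] := by
        rw [Nat.sub_add_cancel (by omega)]; exact h3
      exact Nat.ModEq.add_right_cancel' 1 this
    have h5 : w m = w (t - 1) := by rw [hwm m hm, h4, hwm (t - 1) (by omega)]
    apply hw (t - 1)
    rw [Nat.sub_add_cancel (by omega), ← h5, h1]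

theorem periodic_gcd {w : ℕ → Fin (2 * r)} {c l : ℕ} (hc : 0 < c) (hcl : c < l)
    (h1 : ∀ m, w (m + c) = w m) (h2 : ∀ m, w (m + l) = w m) (m : ℕ) :
    w (m + Nat.gcd c l) = w m := by
  have h1' : ∀ x m, w (m + c * x) = w m := by
    intro x
    induction x with
    | zero => simp
    | succ x ih => intro m; rw [Nat.mul_succ, ← add_assoc, h1, ih]
  have h2' : ∀ x m, w (m + l * x) = w m := by
    intro x
    induction x with
    | zero => simp
    | succ x ih => intro m; rw [Nat.mul_succ, ← add_assoc, h2, ih]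
  obtain ⟨x, -, hx⟩ := Nat.exists_mul_mod_eq_gcd (n := c) (k := l)
    (lt_of_le_of_lt (Nat.gcd_le_left _ hc) hcl)
  rw [← h1' x m, ← hx, ← h2' (c * x / l) (m + c * x % l), add_assoc, Nat.mod_add_div]

/-- A closed trajectory contains a first return, which is a coincidence for a shifted start. -/
theorem exists_first_return {σ : Fin r → Equiv.Perm (Fin n)} {w : ℕ → Fin (2 * r)} {i : Fin n}
    {l : ℕ} (hl : 0 < l) (hper : ∀ m, w (m + l) = w m) (hcl : walk σ w i l = i) :
    ∃ s < l, ∃ c, 0 < c ∧ c ≤ l ∧ walk σ w i (s + c) = walk σ w i s ∧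
      (∀ a < c, ∀ b < c, walk σ w i (s + a) = walk σ w i (s + b) → a = b) ∧
      (c = l → ∀ a < l, ∀ b < l, walk σ w i a = walk σ w i b → a = b) := by
  have hp : ∀ m, walk σ w i (m + l) = walk σ w i m := by
    intro m
    rw [add_comm, walk_add, hcl]
    congr 1
    funext j; rw [add_comm, hper]
  have hpm : ∀ m, walk σ w i m = walk σ w i (m % l) := by
    intro m
    induction m using Nat.strong_induction_on with
    | _ m ih =>
      rcases Nat.lt_or_ge m l with h | h
      · rw [Nat.mod_eq_of_lt h]
      · rw [Nat.mod_eq_sub_mod h, ← ih (m - l) (by omega), ← hp (m - l), Nat.sub_add_cancel h]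
  classical
  have hex : ∃ c, 0 < c ∧ ∃ s, walk σ w i (s + c) = walk σ w i s := ⟨l, hl, 0, hp 0⟩
  set c := Nat.find hex with hcdef
  obtain ⟨hc0, s, hs⟩ : 0 < c ∧ ∃ s, walk σ w i (s + c) = walk σ w i s := Nat.find_spec hex
  have hmin : ∀ a b, walk σ w i a = walk σ w i b → a < b → c ≤ b - a := fun a b h hab =>
    Nat.find_min' hex ⟨by omega, a, by rw [Nat.add_sub_cancel' hab.le, h]⟩
  have hdist : ∀ s, ∀ a < c, ∀ b < c, walk σ w i (s + a) = walk σ w i (s + b) → a = b := by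
    intro s a ha b hb h
    rcases lt_trichotomy a b with h1 | h1 | h1
    · have := hmin _ _ h (by omega); omega
    · exact h1
    · have := hmin _ _ h.symm (by omega); omega
  refine ⟨s % l, Nat.mod_lt _ hl, c, hc0, Nat.find_min' hex ⟨hl, 0, hp 0⟩, ?_, hdist _, ?_⟩
  · rw [← hpm s, ← hs, hpm (s % l + c), hpm (s + c), Nat.mod_add_mod]
  · intro h a ha b hb hab
    exact hdist 0 a (h ▸ ha) b (h ▸ hb) (by simpa using hab)

theorem coincidence_of_first_return {σ : Fin r → Equiv.Perm (Fin n)} {w : ℕ → Fin (2 * r)}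
    {i : Fin n} (hw : ∀ m, w m ≠ wordBar (w (m + 1))) {c : ℕ} (hc : 0 < c)
    (h0 : walk σ w i c = i)
    (hdist : ∀ a < c, ∀ b < c, walk σ w i a = walk σ w i b → a = b) :
    coincidence w (walk σ w i) (c - 1) 0 := by
  refine ⟨notMem_revealed_of_new hw fun m hm h => ?_, ?_⟩
  · have := hdist m (by omega) (c - 1) (by omega) h; omega
  · rw [Nat.sub_add_cancel hc, h0]; rfl

/-- For a sequence which is not a proper power, a closed trajectory that is not simple has two
coincidences, for a shifted start. -/
theorem exists_two_coincidences {σ : Fin r → Equiv.Perm (Fin n)} {w : ℕ → Fin (2 * r)} {i : Fin n}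
    {l : ℕ} (hl : 0 < l) (hw : ∀ m, w m ≠ wordBar (w (m + 1)))
    (hper : ∀ m, w (m + l) = w m)
    (hprim : ∀ d, d ∣ l → (∀ m, w (m + d) = w m) → d = l) (hcl : walk σ w i l = i)
    (hns : ¬ ∀ a < l, ∀ b < l, walk σ w i a = walk σ w i b → a = b) :
    ∃ s < l, ∃ k < l, ∃ k₂ < 2 * l, k < k₂ ∧ ∃ j₂ ≤ k₂,
      coincidence (fun m => w (s + m)) (walk σ (fun m => w (s + m)) (walk σ w i s)) k 0 ∧
      coincidence (fun m => w (s + m)) (walk σ (fun m => w (s + m)) (walk σ w i s)) k₂ j₂ := by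
  obtain ⟨s, hs, c, hc0, hcle, hret, hdist, hsimple⟩ := exists_first_return hl hper hcl
  have hclt : c < l := lt_of_le_of_ne hcle fun h => hns (hsimple h)
  have hpl : walk σ w i (s + l) = walk σ w i s := by
    rw [add_comm, walk_add, hcl]
    congr 1
    funext j; rw [add_comm, hper]
  set v : ℕ → Fin (2 * r) := fun m => w (s + m) with hv
  set x := walk σ w i s with hx
  have hadd : ∀ m, walk σ w i (s + m) = walk σ v x m := fun m => walk_add σ w i s m
  simp only [hadd] at hret hdist hpl
  have hvw : ∀ m, v m ≠ wordBar (v (m + 1)) := fun m => hw (s + m)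
  have hvper : ∀ m, v (m + l) = v m := fun m => by simp only [hv, ← add_assoc, hper]
  have hvl : ∀ m, walk σ v x (l + m) = walk σ v x m := by
    intro m
    rw [walk_add, hpl]
    congr 1
    funext j; rw [add_comm, hvper]
  have hexm : ∃ m < l, v (m + c) ≠ v m := by
    by_contra hcon
    push Not at hcon
    have hall : ∀ m, v (m + c) = v m := by
      intro m
      induction m using Nat.strong_induction_on with
      | _ m ih =>
        rcases Nat.lt_or_ge m l with h | h
        · exact hcon m h
        · have h1 := ih (m - l) (by omega)
          rw [← hvper (m - l + c), ← hvper (m - l)] at h1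
          rwa [Nat.sub_add_cancel h, show m - l + c + l = m + c by omega] at h1
    have hg := periodic_gcd hc0 hclt hall hvper
    have hwg : ∀ m, w (m + Nat.gcd c l) = w m := by
      intro m
      have h1 := hg (m + l * s - s)
      have h2 : s ≤ m + l * s := by nlinarith
      have hmul : ∀ y m, w (m + l * y) = w m := by
        intro y
        induction y with
        | zero => simp
        | succ y ih => intro m; rw [Nat.mul_succ, ← add_assoc, hper, ih]
      simp only [hv] at h1
      rw [show s + (m + l * s - s + Nat.gcd c l) = m + Nat.gcd c l + l * s by omega,
        show s + (m + l * s - s) = m + l * s by omega, hmul, hmul] at h1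
      exact h1
    have h3 := hprim _ (Nat.gcd_dvd_right c l) hwg
    have h4 := Nat.gcd_le_left l hc0
    omega
  classical
  have hext : ∃ t, c ≤ t ∧ v t ≠ v (t - c) := by
    obtain ⟨m, hm, h⟩ := hexm
    exact ⟨m + c, by omega, by simpa using h⟩
  set t := Nat.find hext with htdef
  obtain ⟨hct, htne⟩ : c ≤ t ∧ v t ≠ v (t - c) := Nat.find_spec hext
  have ht2 : t < 2 * l := by
    obtain ⟨m, hm, h⟩ := hexm
    have : t ≤ m + c := Nat.find_min' hext ⟨by omega, by simpa using h⟩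
    omega
  have htmin : ∀ m, c ≤ m → m < t → v m = v (m - c) := fun m hm hmt => by
    by_contra h
    exact Nat.find_min hext hmt ⟨hm, h⟩
  have hexu : ∃ u, t ≤ u ∧ ∃ j ≤ u, walk σ v x (u + 1) = walk σ v x j := by
    refine ⟨2 * l - 1, by omega, 0, by omega, ?_⟩
    rw [show 2 * l - 1 + 1 = l + (l + 0) by omega, hvl, hvl]
  set u := Nat.find hexu with hudef
  obtain ⟨htu, j, hj, huj⟩ : t ≤ u ∧ ∃ j ≤ u, walk σ v x (u + 1) = walk σ v x j :=
    Nat.find_spec hexu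
  have hu2 : u ≤ 2 * l - 1 := Nat.find_min' hexu
    ⟨by omega, 0, by omega, by rw [show 2 * l - 1 + 1 = l + (l + 0) by omega, hvl, hvl]⟩
  refine ⟨s, hs, c - 1, by omega, u, by omega, by omega, j, hj,
    coincidence_of_first_return hvw hc0 hret hdist, ?_, huj⟩
  rcases Nat.eq_or_lt_of_le htu with h | h
  · rw [← h]
    exact notMem_revealed_of_leave hvw hc0 hct hret hdist htmin htne
  · refine notMem_revealed_of_new hvw fun m hm heq => ?_
    refine Nat.find_min hexu (m := u - 1) (by omega) ⟨by omega, m, by omega, ?_⟩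
    rw [Nat.sub_add_cancel (by omega), ← heq]

end RandomWords

section FixedPoints

variable {r n : ℕ}

open Classical in
theorem card_pairs_eq_sum (P : (Fin r → Equiv.Perm (Fin n)) → Fin n → Prop) :
    (Finset.univ.filter fun x : (Fin r → Equiv.Perm (Fin n)) × Fin n => P x.1 x.2).card =
      ∑ i, (Finset.univ.filter fun σ => P σ i).card := by
  simp only [Finset.card_filter]
  rw [Fintype.sum_prod_type_right]

open Classical in
theorem card_coincidence_pairs_mul_le (w : ℕ → Fin (2 * r)) {k j : ℕ} (hj : j ≤ k) :
    (Finset.univ.filter fun x : (Fin r → Equiv.Perm (Fin n)) × Fin n =>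
      coincidence w (walk x.1 w x.2) k j).card * (n - (k + 1)) ≤
      n * Fintype.card (Fin r → Equiv.Perm (Fin n)) := by
  rw [card_pairs_eq_sum fun σ i => coincidence w (walk σ w i) k j, Finset.sum_mul]
  calc _ ≤ ∑ _i : Fin n, Fintype.card (Fin r → Equiv.Perm (Fin n)) := by
        refine Finset.sum_le_sum fun i _ => ?_
        have := card_coincidence_mul_le w i hj (fun _ => True) (fun _ _ _ _ => trivial)
        simpa using this
    _ = _ := by simp

theorem coincidence_congr {w : ℕ → Fin (2 * r)} {p q : ℕ → Fin n} {k j : ℕ} (hj : j ≤ k)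
    (h : ∀ m ≤ k + 1, q m = p m) (hc : coincidence w p k j) : coincidence w q k j := by
  refine ⟨?_, ?_⟩
  · rw [revealed_congr (fun m hm => h m (by omega)), h _ le_rfl]; exact hc.1
  · rw [h _ le_rfl, h _ (by omega)]; exact hc.2

/-- Two coincidences, at times `k` and `k₂`. -/
def coincidence₂ (w : ℕ → Fin (2 * r)) (p : ℕ → Fin n) (k j k₂ j₂ : ℕ) : Prop :=
  coincidence w p k j ∧ coincidence w p k₂ j₂

open Classical in
theorem card_two_coincidences_pairs_mul_le (w : ℕ → Fin (2 * r)) {k j k₂ j₂ : ℕ} (hj : j ≤ k)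
    (hk : k < k₂) (hj₂ : j₂ ≤ k₂) :
    (Finset.univ.filter fun x : (Fin r → Equiv.Perm (Fin n)) × Fin n =>
      coincidence₂ w (walk x.1 w x.2) k j k₂ j₂).card *
        ((n - (k₂ + 1)) * (n - (k + 1))) ≤
      n * Fintype.card (Fin r → Equiv.Perm (Fin n)) := by
  refine le_trans ?_ (card_coincidence_pairs_mul_le w hj)
  rw [← mul_assoc]
  refine Nat.mul_le_mul_right _ ?_
  rw [card_pairs_eq_sum fun σ i => coincidence₂ w (walk σ w i) k j k₂ j₂,
    card_pairs_eq_sum fun σ i => coincidence w (walk σ w i) k j,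
    Finset.sum_mul]
  refine Finset.sum_le_sum fun i _ => ?_
  have := card_coincidence_mul_le w i hj₂ (fun σ => coincidence w (walk σ w i) k j)
    (fun σ σ' h => coincidence_congr hj fun m hm => h m (by omega))
  refine le_trans (le_of_eq ?_) this
  congr 1
  exact congrArg Finset.card (Finset.ext fun σ =>
    by
      rw [@Finset.mem_filter _ _ _ _ _]
      exact (@Finset.mem_filter _ (fun σ => coincidence w (walk σ w i) k j ∧
        coincidence w (walk σ w i) k₂ j₂) _ Finset.univ σ).symm)

open Classical in
theorem card_shifted_pairs_le (w : ℕ → Fin (2 * r)) (s : ℕ)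
    (P : (Fin r → Equiv.Perm (Fin n)) → Fin n → Prop) :
    (Finset.univ.filter fun x : (Fin r → Equiv.Perm (Fin n)) × Fin n =>
      P x.1 (walk x.1 w x.2 s)).card ≤
    (Finset.univ.filter fun x : (Fin r → Equiv.Perm (Fin n)) × Fin n => P x.1 x.2).card := by
  refine Finset.card_le_card_of_injOn (fun x => (x.1, walk x.1 w x.2 s)) ?_ ?_
  · intro x hx
    simpa using hx
  · rintro ⟨σ, i⟩ - ⟨σ', i'⟩ - h
    simp only [Prod.mk.injEq] at h
    obtain ⟨rfl, h⟩ := h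
    rw [walk_injective σ w s h]

open Classical in
/-- The number of pairs (tuple of permutations, point) for which the trajectory of the point closes
up after `l` steps. -/
noncomputable def closedCount (n : ℕ) (w : ℕ → Fin (2 * r)) (l : ℕ) : ℕ :=
  (Finset.univ.filter fun x : (Fin r → Equiv.Perm (Fin n)) × Fin n =>
    walk x.1 w x.2 l = x.2).card

theorem closedCount_le {w : ℕ → Fin (2 * r)} {l : ℕ} (hl : 0 < l)
    (hw : ∀ m, w m ≠ wordBar (w (m + 1))) (hper : ∀ m, w (m + l) = w m) (hn : 4 * l ≤ n) :
    (closedCount n w l : ℝ) ≤ 2 * l ^ 2 * Fintype.card (Fin r → Equiv.Perm (Fin n)) := by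
  classical
  set N := Fintype.card (Fin r → Equiv.Perm (Fin n)) with hN
  let E : ℕ × ℕ → Finset ((Fin r → Equiv.Perm (Fin n)) × Fin n) := fun y =>
    Finset.univ.filter fun x => coincidence (fun m => w (y.1 + m))
      (walk x.1 (fun m => w (y.1 + m)) (walk x.1 w x.2 y.1)) y.2 0
  have hE : ∀ y ∈ Finset.range l ×ˢ Finset.range l, (E y).card ≤ 2 * N := by
    rintro ⟨s, k⟩ hy
    simp only [Finset.mem_product, Finset.mem_range] at hy
    have h1 := (card_shifted_pairs_le (n := n) w s fun σ i => coincidence (fun m => w (s + m))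
      (walk σ (fun m => w (s + m)) i) k 0)
    refine h1.trans ?_
    have h2 := card_coincidence_pairs_mul_le (n := n) (fun m => w (s + m)) (Nat.zero_le k)
    rw [← hN] at h2
    have h3 : n ≤ 2 * (n - (k + 1)) := by omega
    have h4 : 0 < n - (k + 1) := by omega
    refine Nat.le_of_mul_le_mul_right (h2.trans ?_) h4
    nlinarith [Nat.mul_le_mul_right N h3]
  have hsub : (Finset.univ.filter fun x : (Fin r → Equiv.Perm (Fin n)) × Fin n =>
      walk x.1 w x.2 l = x.2) ⊆ (Finset.range l ×ˢ Finset.range l).biUnion E := by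
    rintro ⟨σ, i⟩ hx
    simp only [Finset.mem_filter, Finset.mem_univ, true_and] at hx
    obtain ⟨s, hs, c, hc0, hcl, hret, hdist, -⟩ := exists_first_return hl hper hx
    simp only [walk_add] at hret hdist
    simp only [Finset.mem_biUnion, Finset.mem_product, Finset.mem_range, Prod.exists, E,
      Finset.mem_filter, Finset.mem_univ, true_and]
    refine ⟨s, c - 1, ⟨hs, by omega⟩, coincidence_of_first_return (fun m => hw (s + m)) hc0 ?_ hdist⟩
    exact hret
  have := (Finset.card_le_card hsub).trans (Finset.card_biUnion_le_card_mul _ _ _ hE)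
  rw [Finset.card_product, Finset.card_range] at this
  have h' : closedCount n w l ≤ l * l * (2 * N) := this
  calc (closedCount n w l : ℝ) ≤ ((l * l * (2 * N) : ℕ) : ℝ) := by exact_mod_cast h'
    _ = _ := by push_cast; ring

theorem closedCount_le_of_primitive {w : ℕ → Fin (2 * r)} {l : ℕ} (hl : 0 < l)
    (hw : ∀ m, w m ≠ wordBar (w (m + 1))) (hper : ∀ m, w (m + l) = w m)
    (hprim : ∀ d, d ∣ l → (∀ m, w (m + d) = w m) → d = l) (hn : 4 * l ≤ n) :
    (closedCount n w l : ℝ) ≤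
      (1 + 18 * l ^ 4 / n) * Fintype.card (Fin r → Equiv.Perm (Fin n)) := by
  classical
  set N := Fintype.card (Fin r → Equiv.Perm (Fin n)) with hN
  have hn0 : (0 : ℝ) < n := by
    have : 0 < n := by omega
    exact_mod_cast this
  have hl1 : (1 : ℝ) ≤ l := by exact_mod_cast hl
  have hnl : (4 : ℝ) * l ≤ n := by exact_mod_cast hn
  let I := (Finset.range l ×ˢ Finset.range l) ×ˢ (Finset.range (2 * l) ×ˢ Finset.range (2 * l))
  let E : (ℕ × ℕ) × (ℕ × ℕ) → Finset ((Fin r → Equiv.Perm (Fin n)) × Fin n) := fun y =>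
    if y.1.2 < y.2.1 ∧ y.2.2 ≤ y.2.1 then
    Finset.univ.filter fun x => coincidence₂ (fun m => w (y.1.1 + m))
      (walk x.1 (fun m => w (y.1.1 + m)) (walk x.1 w x.2 y.1.1)) y.1.2 0 y.2.1 y.2.2
    else ∅
  have hE : ∀ y ∈ I, ((E y).card : ℝ) ≤ 4 * N / n := by
    rintro ⟨⟨s, k⟩, ⟨k₂, j₂⟩⟩ hy
    simp only [I, Finset.mem_product, Finset.mem_range] at hy
    simp only [E]
    split_ifs with hcond
    · have h1 := (card_shifted_pairs_le (n := n) w s fun σ i => coincidence₂ (fun m => w (s + m))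
        (walk σ (fun m => w (s + m)) i) k 0 k₂ j₂)
      have h2 := card_two_coincidences_pairs_mul_le (n := n) (fun m => w (s + m))
        (Nat.zero_le k) hcond.1 hcond.2
      have h3 := (Nat.mul_le_mul_right _ h1).trans h2
      rw [← hN] at h3
      set c := (Finset.univ.filter fun x : (Fin r → Equiv.Perm (Fin n)) × Fin n =>
        coincidence₂ (fun m => w (s + m)) (walk x.1 (fun m => w (s + m)) (walk x.1 w x.2 s)) k 0
          k₂ j₂).card with hc
      have h4 : (c : ℝ) * (((n - (k₂ + 1) : ℕ) : ℝ) * ((n - (k + 1) : ℕ) : ℝ)) ≤ n * N := by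
        exact_mod_cast h3
      have h5 : (n : ℝ) / 2 ≤ ((n - (k₂ + 1) : ℕ) : ℝ) := by
        have : n ≤ 2 * (n - (k₂ + 1)) := by omega
        have : (n : ℝ) ≤ 2 * ((n - (k₂ + 1) : ℕ) : ℝ) := by exact_mod_cast this
        linarith
      have h6 : (n : ℝ) / 2 ≤ ((n - (k + 1) : ℕ) : ℝ) := by
        have : n ≤ 2 * (n - (k + 1)) := by omega
        have : (n : ℝ) ≤ 2 * ((n - (k + 1) : ℕ) : ℝ) := by exact_mod_cast this
        linarith
      have h7 : (c : ℝ) * ((n : ℝ) / 2 * (n / 2)) ≤ n * N := by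
        refine le_trans ?_ h4
        gcongr
      rw [le_div_iff₀ hn0]
      nlinarith
    · simp only [Finset.card_empty, Nat.cast_zero]; positivity
  have hsub : (Finset.univ.filter fun x : (Fin r → Equiv.Perm (Fin n)) × Fin n =>
      walk x.1 w x.2 l = x.2) ⊆
      (Finset.univ.filter fun x : (Fin r → Equiv.Perm (Fin n)) × Fin n =>
        coincidence w (walk x.1 w x.2) (l - 1) 0) ∪ I.biUnion E := by
    rintro ⟨σ, i⟩ hx
    simp only [Finset.mem_filter, Finset.mem_univ, true_and] at hx
    rw [Finset.mem_union]
    by_cases hs : ∀ a < l, ∀ b < l, walk σ w i a = walk σ w i b → a = b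
    · left
      simp only [Finset.mem_filter, Finset.mem_univ, true_and]
      exact coincidence_of_first_return hw hl hx hs
    · right
      obtain ⟨s, hs, k, hk, k₂, hk₂, hkk, j₂, hj₂, h1, h2⟩ :=
        exists_two_coincidences hl hw hper hprim hx hs
      rw [Finset.mem_biUnion]
      refine ⟨((s, k), (k₂, j₂)), ?_, ?_⟩
      · simp only [I, Finset.mem_product, Finset.mem_range]
        omega
      · simp only [E, if_pos (And.intro hkk hj₂), Finset.mem_filter, Finset.mem_univ, true_and]
        exact ⟨h1, h2⟩
  have h1 := (Finset.card_le_card hsub).trans (Finset.card_union_le _ _)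
  have h2 : ((I.biUnion E).card : ℝ) ≤ 16 * l ^ 4 * N / n := by
    calc ((I.biUnion E).card : ℝ) ≤ ∑ y ∈ I, ((E y).card : ℝ) := by
          exact_mod_cast Finset.card_biUnion_le
      _ ≤ ∑ _y ∈ I, 4 * (N : ℝ) / n := Finset.sum_le_sum hE
      _ = _ := by
        rw [Finset.sum_const, nsmul_eq_mul]
        simp only [I, Finset.card_product, Finset.card_range]
        push_cast; ring
  have h3 := card_coincidence_pairs_mul_le (n := n) w (Nat.zero_le (l - 1))
  rw [← hN, Nat.sub_add_cancel hl] at h3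
  set c := (Finset.univ.filter fun x : (Fin r → Equiv.Perm (Fin n)) × Fin n =>
        coincidence w (walk x.1 w x.2) (l - 1) 0).card with hc
  have h4 : (c : ℝ) * (n - l) ≤ n * N := by
    rw [← Nat.cast_sub (by omega)]; exact_mod_cast h3
  have h5 : (c : ℝ) ≤ (1 + 2 * l / n) * N := by
    have h6 : (n : ℝ) ≤ (1 + 2 * l / n) * (n - l) := by
      have : (1 + 2 * (l : ℝ) / n) * (n - l) = n + l * (n - 2 * l) / n := by field_simp; ring
      rw [this]
      have : 0 ≤ (l : ℝ) * (n - 2 * l) / n := by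
        apply div_nonneg _ hn0.le
        apply mul_nonneg <;> linarith
      linarith
    have h7 : (0 : ℝ) < n - l := by linarith
    have hN0 : (0 : ℝ) ≤ N := by positivity
    nlinarith [mul_le_mul_of_nonneg_right h6 hN0]
  have h8 : (closedCount n w l : ℝ) ≤ c + (I.biUnion E).card := by
    have : closedCount n w l ≤ c + (I.biUnion E).card := h1
    exact_mod_cast this
  have h9 : (l : ℝ) ≤ l ^ 4 := le_self_pow₀ hl1 (by norm_num)
  calc (closedCount n w l : ℝ) ≤ (1 + 2 * l / n) * N + 16 * l ^ 4 * N / n := by linarith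
    _ ≤ (1 + 2 * l ^ 4 / n) * N + 16 * l ^ 4 * N / n := by gcongr
    _ = _ := by ring

theorem notMem_revealed_start {σ : Fin r → Equiv.Perm (Fin n)} {w : ℕ → Fin (2 * r)} {i : Fin n}
    {l : ℕ} (hl : 0 < l) (hw : ∀ m, w m ≠ wordBar (w (m + 1))) (hper : ∀ m, w (m + l) = w m)
    (hdist : ∀ a < l, ∀ b < l, walk σ w i a = walk σ w i b → a = b) :
    i ∉ revealed w (walk σ w i) (l - 1) := by
  rintro ⟨m, hm, ⟨h1, h2⟩ | ⟨h1, h2⟩⟩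
  · have := hdist (m + 1) (by omega) 0 hl h2; omega
  · obtain rfl := hdist m (by omega) 0 hl h2
    have h3 := hw (l - 1)
    rw [Nat.sub_add_cancel hl] at h3
    have h4 := hper 0
    rw [zero_add] at h4
    rw [h4, h1, wordBar_wordBar] at h3
    exact h3 rfl

theorem le_closedCount {w : ℕ → Fin (2 * r)} {l : ℕ} (hl : 0 < l)
    (hw : ∀ m, w m ≠ wordBar (w (m + 1))) (hper : ∀ m, w (m + l) = w m) (hn : 4 * l ≤ n) :
    (1 - 18 * l ^ 4 / n) * Fintype.card (Fin r → Equiv.Perm (Fin n)) ≤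
      (closedCount n w l : ℝ) := by
  classical
  set N := Fintype.card (Fin r → Equiv.Perm (Fin n)) with hN
  have hn0 : (0 : ℝ) < n := by
    have : 0 < n := by omega
    exact_mod_cast this
  have hl1 : (1 : ℝ) ≤ l := by exact_mod_cast hl
  let F : Finset ((Fin r → Equiv.Perm (Fin n)) × Fin n) := Finset.univ.filter fun x =>
    ∀ a < l, ∀ b < l, walk x.1 w x.2 a = walk x.1 w x.2 b → a = b
  let G : Finset ((Fin r → Equiv.Perm (Fin n)) × Fin n) := Finset.univ.filter fun x =>
    walk x.1 w x.2 l = x.2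
  have hFG : F.card ≤ G.card * n := by
    have : G.card * n = (G ×ˢ (Finset.univ : Finset (Fin n))).card := by
      rw [Finset.card_product, Finset.card_univ, Fintype.card_fin]
    rw [this]
    have key : ∀ x ∈ F,
        (∀ m ≤ l - 1, walk (twistPerm x.1 (w (l - 1)) (Equiv.swap (walk x.1 w x.2 l) x.2)) w x.2 m
          = walk x.1 w x.2 m) ∧
        walk (twistPerm x.1 (w (l - 1)) (Equiv.swap (walk x.1 w x.2 l) x.2)) w x.2 l = x.2 := by
      rintro ⟨σ, i⟩ hx
      simp only [F, Finset.mem_filter, Finset.mem_univ, true_and] at hx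
      have h1 : walk σ w i (l - 1 + 1) ∉ revealed w (walk σ w i) (l - 1) :=
        notMem_revealed_of_new hw fun m hm h => by
          have := hx m (by omega) (l - 1) (by omega) h; omega
      have h2 := walk_twist h1 (notMem_revealed_start hl hw hper hx)
      rwa [Nat.sub_add_cancel hl] at h2
    refine Finset.card_le_card_of_injOn
      (fun x => ((twistPerm x.1 (w (l - 1)) (Equiv.swap (walk x.1 w x.2 l) x.2), x.2),
        walk x.1 w x.2 l)) ?_ ?_
    · intro x hx
      simp only [Finset.coe_product, Set.mem_prod, Finset.mem_coe, G, Finset.mem_filter,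
        Finset.mem_univ, true_and, and_true]
      exact (key x hx).2
    · rintro ⟨σ, i⟩ hx ⟨σ', i'⟩ hx' h
      simp only [Prod.mk.injEq] at h
      obtain ⟨⟨h1, rfl⟩, h2⟩ := h
      have := congrArg (fun s => twistPerm s (w (l - 1)) (Equiv.swap (walk σ w i l) i)) h1
      rw [← h2, twistPerm_twistPerm, twistPerm_twistPerm, Equiv.swap_mul_self, twistPerm_one,
        twistPerm_one] at this
      rw [this]
  let E : ℕ × ℕ → Finset ((Fin r → Equiv.Perm (Fin n)) × Fin n) := fun y =>
    if y.2 ≤ y.1 then Finset.univ.filter fun x => coincidence w (walk x.1 w x.2) y.1 y.2 else ∅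
  have hE : ∀ y ∈ Finset.range l ×ˢ Finset.range l, (E y).card ≤ 2 * N := by
    rintro ⟨k, j⟩ hy
    simp only [Finset.mem_product, Finset.mem_range] at hy
    simp only [E]
    split_ifs with hjk
    · have h2 := card_coincidence_pairs_mul_le (n := n) w hjk
      rw [← hN] at h2
      have h3 : n ≤ 2 * (n - (k + 1)) := by omega
      have h4 : 0 < n - (k + 1) := by omega
      refine Nat.le_of_mul_le_mul_right (h2.trans ?_) h4
      nlinarith [Nat.mul_le_mul_right N h3]
    · simp
  have hsub : Finset.univ ⊆ F ∪ (Finset.range l ×ˢ Finset.range l).biUnion E := by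
    rintro ⟨σ, i⟩ -
    rw [Finset.mem_union]
    by_cases hs : ∀ a < l, ∀ b < l, walk σ w i a = walk σ w i b → a = b
    · left; simpa [F] using hs
    · right
      have hex : ∃ k, k + 1 < l ∧ ∃ j ≤ k, walk σ w i (k + 1) = walk σ w i j := by
        push Not at hs
        obtain ⟨a, ha, b, hb, hab, hne⟩ := hs
        rcases lt_or_gt_of_ne hne with h | h
        · exact ⟨b - 1, by omega, a, by omega, by rw [Nat.sub_add_cancel (by omega), hab]⟩
        · exact ⟨a - 1, by omega, b, by omega, by rw [Nat.sub_add_cancel (by omega), hab]⟩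
      obtain ⟨hk, j, hj, hjk⟩ := Nat.find_spec hex
      set k := Nat.find hex with hkdef
      rw [Finset.mem_biUnion]
      refine ⟨(k, j), ?_, ?_⟩
      · simp only [Finset.mem_product, Finset.mem_range]; omega
      · simp only [E, if_pos hj, Finset.mem_filter, Finset.mem_univ, true_and]
        refine ⟨notMem_revealed_of_new hw fun m hm h => ?_, hjk⟩
        refine Nat.find_min hex (m := k - 1) (by omega) ⟨by omega, m, by omega, ?_⟩
        rw [Nat.sub_add_cancel (by omega), h]
  have h1 := (Finset.card_le_card hsub).trans (Finset.card_union_le _ _)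
  have h2 := Finset.card_biUnion_le_card_mul _ _ _ hE
  rw [Finset.card_product, Finset.card_range] at h2
  rw [Finset.card_univ, Fintype.card_prod, ← hN, Fintype.card_fin] at h1
  have h3 : N * n ≤ closedCount n w l * n + l * l * (2 * N) :=
    h1.trans (Nat.add_le_add hFG h2)
  have h4 : (N : ℝ) * n ≤ closedCount n w l * n + l * l * (2 * N) := by exact_mod_cast h3
  have h9 : (l : ℝ) * l ≤ l ^ 4 := by nlinarith [pow_le_pow_right₀ hl1 (show 2 ≤ 4 by norm_num)]
  have h10 : (N : ℝ) * n - 18 * l ^ 4 * N ≤ closedCount n w l * n := by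
    have hN0 : (0 : ℝ) ≤ N := by positivity
    nlinarith [mul_le_mul_of_nonneg_right h9 hN0, show (0 : ℝ) ≤ l ^ 4 * N by positivity]
  have h11 : (1 - 18 * (l : ℝ) ^ 4 / n) * N = (N * n - 18 * l ^ 4 * N) / n := by field_simp
  rw [h11, div_le_iff₀ hn0]
  exact h10

end FixedPoints

section WordReduction

variable {r n : ℕ}

/-- Every list of letters represents, in every group, either the identity or a conjugate of a
nonempty cyclically reduced word that is not longer. -/
theorem exists_cyclic_reduction (x : List (Fin (2 * r))) :
    (∀ (G : Type) [Group G] (f : Fin (2 * r) → G), (∀ a, f (wordBar a) = (f a)⁻¹) →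
      (x.map f).prod = 1) ∨
    ∃ y c : List (Fin (2 * r)), y ≠ [] ∧ y.length ≤ x.length ∧ IsWord y ∧ arrow y y ∧
      ∀ (G : Type) [Group G] (f : Fin (2 * r) → G), (∀ a, f (wordBar a) = (f a)⁻¹) →
        (x.map f).prod = (c.map f).prod * (y.map f).prod * ((c.map f).prod)⁻¹ := by
  induction hlen : x.length using Nat.strong_induction_on generalizing x with
  | _ m ih =>
  subst hlen
  have step : ∀ (x' d : List (Fin (2 * r))), x'.length < x.length →
      (∀ (G : Type) [Group G] (f : Fin (2 * r) → G), (∀ a, f (wordBar a) = (f a)⁻¹) →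
        (x.map f).prod = (d.map f).prod * (x'.map f).prod * ((d.map f).prod)⁻¹) →
      (∀ (G : Type) [Group G] (f : Fin (2 * r) → G), (∀ a, f (wordBar a) = (f a)⁻¹) →
        (x.map f).prod = 1) ∨
      ∃ y c : List (Fin (2 * r)), y ≠ [] ∧ y.length ≤ x.length ∧ IsWord y ∧ arrow y y ∧
        ∀ (G : Type) [Group G] (f : Fin (2 * r) → G), (∀ a, f (wordBar a) = (f a)⁻¹) →
          (x.map f).prod = (c.map f).prod * (y.map f).prod * ((c.map f).prod)⁻¹ := by
    intro x' d hx' hd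
    rcases ih _ hx' x' rfl with h | ⟨y, c, h1, h2, h3, h4, h5⟩
    · left
      intro G _ f hf
      rw [hd G f hf, h G f hf]; group
    · refine Or.inr ⟨y, d ++ c, h1, by omega, h3, h4, fun G _ f hf => ?_⟩
      rw [hd G f hf, h5 G f hf, List.map_append, List.prod_append]; group
  by_cases hx0 : x = []
  · left; intro G _ f _; simp [hx0]
  by_cases hch : IsWord x
  · by_cases har : arrow x x
    · exact Or.inr ⟨x, [], hx0, le_rfl, hch, har, fun G _ f _ => by simp⟩
    · simp only [arrow, not_forall, not_not] at har
      obtain ⟨p, hp, q, hq, hpq⟩ := har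
      obtain ⟨t, rfl⟩ : ∃ t, x = q :: t := by
        cases x with
        | nil => exact absurd rfl hx0
        | cons a t => simp at hq; exact ⟨t, by rw [hq]⟩
      rcases List.eq_nil_or_concat t with rfl | ⟨t', p', rfl⟩
      · simp at hp
        exact absurd (hp.trans hpq).symm (wordBar_ne q)
      · have hp' : (q :: t'.concat p').getLast? = some p' := by
          rw [List.concat_eq_append, ← List.cons_append, List.getLast?_append]; simp
        rw [hp', Option.mem_some_iff] at hp
        subst hp
        refine step t' [q] (by simp) fun G _ f hf => ?_
        simp [hpq, hf, mul_assoc]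
  · rw [IsWord, List.Chain', List.isChain_iff_forall_rel_of_append_cons_cons] at hch
    push Not at hch
    obtain ⟨a, b, l₁, l₂, rfl, hab⟩ := hch
    refine step (l₁ ++ l₂) [] (by simp) fun G _ f hf => ?_
    simp [hab, hf]

/-- The product `f (w (k - 1)) ⋯ f (w 0)`. -/
def revProd {G : Type} [Group G] (f : Fin (2 * r) → G) (w : ℕ → Fin (2 * r)) : ℕ → G
  | 0 => 1
  | k + 1 => f (w k) * revProd f w k

theorem walk_eq_revProd (σ : Fin r → Equiv.Perm (Fin n)) (w : ℕ → Fin (2 * r)) (i : Fin n)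
    (k : ℕ) : walk σ w i k = revProd (sigmaPerm σ) w k i := by
  induction k with
  | zero => rfl
  | succ k ih => rw [walk, revProd, ih]; rfl

theorem revProd_add {G : Type} [Group G] (f : Fin (2 * r) → G) (w : ℕ → Fin (2 * r)) {d : ℕ}
    (hd : ∀ m, w (m + d) = w m) (k : ℕ) :
    revProd f w (k + d) = revProd f w k * revProd f w d := by
  induction k with
  | zero => simp [revProd]
  | succ k ih => rw [add_right_comm, revProd, ih, revProd, hd, mul_assoc]

theorem revProd_mul {G : Type} [Group G] (f : Fin (2 * r) → G) (w : ℕ → Fin (2 * r)) {d : ℕ}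
    (hd : ∀ m, w (m + d) = w m) (q : ℕ) : revProd f w (d * q) = revProd f w d ^ q := by
  induction q with
  | zero => simp [revProd]
  | succ q ih => rw [mul_add, mul_one, revProd_add f w hd, ih, pow_succ]

theorem revProd_eq_prod {G : Type} [Group G] (f : Fin (2 * r) → G) (w : ℕ → Fin (2 * r)) (k : ℕ) :
    revProd f w k = ((((List.range k).map w).reverse).map f).prod := by
  induction k with
  | zero => rfl
  | succ k ih => rw [revProd, ih, List.range_succ]; simp

/-- A cyclically reduced word read backwards, as a reduced periodic sequence. -/
theorem exists_periodic_of_cyclic {y : List (Fin (2 * r))} (hy : y ≠ []) (hw : IsWord y)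
    (hc : arrow y y) :
    ∃ w : ℕ → Fin (2 * r), (∀ m, w m ≠ wordBar (w (m + 1))) ∧
      (∀ m, w (m + y.length) = w m) ∧ ((List.range y.length).map w).reverse = y := by
  have hl : 0 < y.length := List.length_pos_of_ne_nil hy
  have hlt : ∀ m, y.length - 1 - m % y.length < y.length := fun m => by omega
  refine ⟨fun m => y[y.length - 1 - m % y.length]'(hlt m), ?_, ?_, ?_⟩
  · intro m h
    rw [IsWord, List.Chain', List.isChain_iff_getElem] at hw
    have hm := Nat.mod_lt m hl
    have hs : (m + 1) % y.length = if m % y.length + 1 = y.length then 0 else m % y.length + 1 := by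
      rw [Nat.add_mod]
      split_ifs with h1
      · by_cases h2 : y.length = 1
        · simp [h2, Nat.mod_one]
        · rw [Nat.mod_eq_of_lt (a := 1) (by omega), h1, Nat.mod_self]
      · rw [Nat.mod_eq_of_lt (a := 1) (by omega), Nat.mod_eq_of_lt (by omega)]
    split_ifs at hs with h1
    · have e1 : y.length - 1 - m % y.length = 0 := by omega
      have e2 : y.length - 1 - (m + 1) % y.length = y.length - 1 := by omega
      simp only [e1, e2] at h
      refine hc y[y.length - 1] ?_ y[0] ?_ ?_
      · rw [List.getLast?_eq_getElem?]; simp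
      · rw [List.head?_eq_getElem?]; simp
      · rw [h, wordBar_wordBar]
    · have e1 : y.length - 1 - m % y.length = y.length - 1 - (m + 1) % y.length + 1 := by omega
      have := hw (y.length - 1 - (m + 1) % y.length) (by omega)
      apply this
      simp only [e1] at h
      rw [h, wordBar_wordBar]
  · intro m; simp
  · apply List.ext_getElem
    · simp
    · intro i h1 h2
      simp only [List.getElem_reverse, List.getElem_map, List.getElem_range, List.length_map,
        List.length_range]
      congr 1
      rw [Nat.mod_eq_of_lt (by omega)]
      omega

theorem fixCount_conj (π ρ : Equiv.Perm (Fin n)) : fixCount (ρ * π * ρ⁻¹) = fixCount π := by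
  refine Finset.card_nbij' (fun i => ρ⁻¹ i) (fun i => ρ i) ?_ ?_ ?_ ?_
  · intro i hi
    simp only [Finset.coe_filter, Finset.mem_univ, true_and, Set.mem_ofPred_eq] at hi ⊢
    rw [Equiv.Perm.eq_inv_iff_eq]
    exact hi
  · intro i hi
    simp only [Finset.coe_filter, Finset.mem_univ, true_and, Set.mem_ofPred_eq] at hi ⊢
    simp [hi]
  · intro i _; simp
  · intro i _; simp

theorem fixCount_le (π : Equiv.Perm (Fin n)) : fixCount π ≤ n := by
  simpa [fixCount] using Finset.card_le_univ (Finset.univ.filter fun i : Fin n => π i = i)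

theorem sum_fixCount_revProd (w : ℕ → Fin (2 * r)) (l : ℕ) :
    ∑ σ : Fin r → Equiv.Perm (Fin n), fixCount (revProd (sigmaPerm σ) w l) = closedCount n w l := by
  classical
  simp only [closedCount, fixCount, Finset.card_filter]
  rw [Fintype.sum_prod_type]
  simp only [walk_eq_revProd]

theorem prod_mirror {G : Type} [Group G] (f : Fin (2 * r) → G)
    (hf : ∀ a, f (wordBar a) = (f a)⁻¹) (v : List (Fin (2 * r))) :
    ((mirror v).map f).prod = ((v.map f).prod)⁻¹ := by
  rw [List.prod_inv_reverse, mirror, List.map_reverse, List.map_map, List.map_map]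
  congr 3
  funext a; exact hf a

/-- The expected number of fixed points of the permutation represented by the word `x`. -/
noncomputable def meanFix (n : ℕ) (x : List (Fin (2 * r))) : ℝ :=
  (∑ σ : Fin r → Equiv.Perm (Fin n), (fixCount (wordPerm σ x) : ℝ)) /
    (Fintype.card (Fin r → Equiv.Perm (Fin n)) : ℝ)

theorem abs_meanFix_sub_one_le (hn : 1 ≤ n) (x : List (Fin (2 * r))) :
    |meanFix n x - 1| ≤ n := by
  have hN : (0 : ℝ) < Fintype.card (Fin r → Equiv.Perm (Fin n)) := by
    exact_mod_cast Fintype.card_pos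
  have h0 : 0 ≤ meanFix n x := by unfold meanFix; positivity
  have h1 : meanFix n x ≤ n := by
    rw [meanFix, div_le_iff₀ hN, mul_comm]
    calc _ ≤ ∑ _σ : Fin r → Equiv.Perm (Fin n), (n : ℝ) :=
          Finset.sum_le_sum fun σ _ => by exact_mod_cast fixCount_le _
      _ = _ := by simp
  have h2 : (1 : ℝ) ≤ n := by exact_mod_cast hn
  rw [abs_le]; constructor <;> linarith

/-- Unless `x` is trivial in every group, the mean number of fixed points is close to one, up to a
polynomial in the length, with a much better bound if `x` is not a proper power. -/
theorem meanFix_cases (x : List (Fin (2 * r))) :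
    (∀ (G : Type) [Group G] (f : Fin (2 * r) → G), (∀ a, f (wordBar a) = (f a)⁻¹) →
      (x.map f).prod = 1) ∨
    ((∀ n : ℕ, 4 * x.length ≤ n → |meanFix n x - 1| ≤ 2 * x.length ^ 2 + 1) ∧
      ((∃ q : ℕ, 2 ≤ q ∧ ∃ t : List (Fin (2 * r)), ∀ (G : Type) [Group G] (f : Fin (2 * r) → G),
        (∀ a, f (wordBar a) = (f a)⁻¹) → ∃ h : G, (∃ c : List (Fin (2 * r)),
          h = (c.map f).prod * (t.map f).prod * ((c.map f).prod)⁻¹) ∧ (x.map f).prod = h ^ q) ∨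
        ∀ n : ℕ, 4 * x.length ≤ n → |meanFix n x - 1| ≤ 18 * x.length ^ 4 / n)) := by
  rcases exists_cyclic_reduction x with h | ⟨y, c, hy, hyx, hw, har, heq⟩
  · exact Or.inl h
  right
  obtain ⟨w, hw1, hw2, hw3⟩ := exists_periodic_of_cyclic hy hw har
  set l := y.length with hl
  have hl0 : 0 < l := List.length_pos_of_ne_nil hy
  have hlx : (l : ℝ) ≤ x.length := by exact_mod_cast hyx
  have hprod : ∀ (G : Type) [Group G] (f : Fin (2 * r) → G), (∀ a, f (wordBar a) = (f a)⁻¹) →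
      (x.map f).prod = (c.map f).prod * revProd f w l * ((c.map f).prod)⁻¹ := by
    intro G _ f hf
    rw [revProd_eq_prod, hw3, heq G f hf]
  have hN : ∀ n : ℕ, (0 : ℝ) < Fintype.card (Fin r → Equiv.Perm (Fin n)) := fun n => by
    exact_mod_cast Fintype.card_pos
  have hmean : ∀ n : ℕ, meanFix n x * Fintype.card (Fin r → Equiv.Perm (Fin n)) =
      closedCount n w l := by
    intro n
    rw [meanFix, div_mul_cancel₀ _ (hN n).ne', ← sum_fixCount_revProd]
    push_cast
    refine Finset.sum_congr rfl fun σ _ => ?_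
    rw [wordPerm, hprod _ _ (sigmaPerm_wordBar σ), fixCount_conj]
  refine ⟨fun n hn => ?_, ?_⟩
  · have h1 := closedCount_le hl0 hw1 hw2 (n := n) (by omega)
    rw [← hmean n] at h1
    have h2 := le_of_mul_le_mul_right h1 (hN n)
    have h3 : 0 ≤ meanFix n x := by unfold meanFix; positivity
    have h4 : (l : ℝ) ^ 2 ≤ x.length ^ 2 := by gcongr
    have h5 : (0 : ℝ) ≤ (x.length : ℝ) ^ 2 := by positivity
    rw [abs_le]; constructor <;> linarith
  · by_cases hprim : ∀ d, d ∣ l → (∀ m, w (m + d) = w m) → d = l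
    · right
      intro n hn
      have h1 := closedCount_le_of_primitive hl0 hw1 hw2 hprim (n := n) (by omega)
      have h2 := le_closedCount hl0 hw1 hw2 (n := n) (by omega)
      rw [← hmean n] at h1 h2
      have h3 := le_of_mul_le_mul_right h1 (hN n)
      have h4 := le_of_mul_le_mul_right h2 (hN n)
      have h5 : 18 * (l : ℝ) ^ 4 / n ≤ 18 * x.length ^ 4 / n := by gcongr
      rw [abs_le]; constructor <;> linarith
    · left
      push Not at hprim
      obtain ⟨d, ⟨q, hq⟩, hd, hne⟩ := hprim
      refine ⟨q, ?_, ((List.range d).map w).reverse, fun G _ f hf => ⟨_, ⟨c, rfl⟩, ?_⟩⟩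
      · rcases q with _ | _ | q
        · omega
        · omega
        · omega
      · rw [hprod G f hf, hq, revProd_mul f w hd, revProd_eq_prod, conj_pow]

end WordReduction

namespace Schottky

variable (S : Schottky)

theorem mean_fixCount_eq (n : ℕ) (u v : List (Fin (2 * S.r))) :
    (∑ σ : Fin S.r → Equiv.Perm (Fin n), (fixCount (wordPerm σ u * (wordPerm σ v)⁻¹) : ℝ)) /
      (Fintype.card (Fin S.r → Equiv.Perm (Fin n)) : ℝ) = meanFix n (u ++ mirror v) := by
  rw [meanFix]
  congr 1
  refine Finset.sum_congr rfl fun σ _ => ?_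
  simp only [wordPerm]
  rw [List.map_append, List.prod_append, prod_mirror _ (sigmaPerm_wordBar σ)]

theorem meanFix_pair_cases (u v : List (Fin (2 * S.r))) :
    S.wprod u * (S.wprod v)⁻¹ = 1 ∨
    ((∀ n : ℕ, 4 * (u.length + v.length) ≤ n →
        |meanFix n (u ++ mirror v) - 1| ≤ 2 * (u.length + v.length) ^ 2 + 1) ∧
      ((∃ γ₀ ∈ S.SGroup, ∃ q : ℕ, 2 ≤ q ∧ S.wprod u * (S.wprod v)⁻¹ = (γ₀ : SL2) ^ q) ∨
        ∀ n : ℕ, 4 * (u.length + v.length) ≤ n →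
          |meanFix n (u ++ mirror v) - 1| ≤ 18 * (u.length + v.length) ^ 4 / n)) := by
  have hlen : (u ++ mirror v).length = u.length + v.length := by simp [mirror]
  have hprod : ((u ++ mirror v).map S.g).prod = S.wprod u * (S.wprod v)⁻¹ := by
    rw [List.map_append, List.prod_append, prod_mirror _ S.g_bar]; rfl
  have h := meanFix_cases (u ++ mirror v)
  rw [hlen] at h
  rcases h with h | ⟨h1, ⟨q, hq, t, h2⟩ | h2⟩
  · exact Or.inl (by rw [← hprod, h SL2 S.g S.g_bar])
  · obtain ⟨γ, ⟨c, rfl⟩, hγ⟩ := h2 SL2 S.g S.g_bar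
    refine Or.inr ⟨fun n hn => by simpa using h1 n hn, Or.inl ⟨_, ?_, q, hq, hprod ▸ hγ⟩⟩
    exact S.SGroup.mul_mem (S.SGroup.mul_mem (S.wprod_mem c) (S.wprod_mem t))
      (S.SGroup.inv_mem (S.wprod_mem c))
  · exact Or.inr ⟨fun n hn => by simpa using h1 n hn, Or.inr fun n hn => by simpa using h2 n hn⟩

end Schottky

/-- The linear action of `SL(2,ℝ)` on the plane. -/
noncomputable def planeAct (g : SL2) (p : Fin 2 → ℝ) : Fin 2 → ℝ := g.1.mulVec p

theorem planeAct_zero (g : SL2) (p : Fin 2 → ℝ) :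
    planeAct g p 0 = g.1 0 0 * p 0 + g.1 0 1 * p 1 := by
  simp [planeAct, Matrix.mulVec, dotProduct, Fin.sum_univ_two]

theorem planeAct_one' (g : SL2) (p : Fin 2 → ℝ) :
    planeAct g p 1 = g.1 1 0 * p 0 + g.1 1 1 * p 1 := by
  simp [planeAct, Matrix.mulVec, dotProduct, Fin.sum_univ_two]

theorem one_planeAct (p : Fin 2 → ℝ) : planeAct 1 p = p := by
  simp [planeAct]

theorem mul_planeAct (g h : SL2) (p : Fin 2 → ℝ) :
    planeAct (g * h) p = planeAct g (planeAct h p) := by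
  rw [planeAct, planeAct, planeAct, Matrix.mulVec_mulVec, Matrix.SpecialLinearGroup.coe_mul]

theorem planeAct_smul (g : SL2) (c : ℝ) (p : Fin 2 → ℝ) :
    planeAct g (c • p) = c • planeAct g p := by
  simp [planeAct, Matrix.mulVec_smul]

theorem inv_planeAct_planeAct (g : SL2) (p : Fin 2 → ℝ) : planeAct g⁻¹ (planeAct g p) = p := by
  rw [← mul_planeAct, inv_mul_cancel, one_planeAct]

theorem planeAct_ne_zero (g : SL2) {p : Fin 2 → ℝ} (hp : p ≠ 0) : planeAct g p ≠ 0 := by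
  intro h
  apply hp
  rw [← inv_planeAct_planeAct g p, h]
  simp [planeAct]

theorem mobiusS_infty (g : SL2) :
    mobiusS g OnePoint.infty = if (g.1 1 0 : ℝ) = 0 then OnePoint.infty
      else (((g.1 0 0 / g.1 1 0 : ℝ) : ℂ) : OnePoint ℂ) := rfl

theorem mobiusS_coe (g : SL2) (w : ℂ) :
    mobiusS g (w : OnePoint ℂ) = if ((g.1 1 0 : ℂ) * w + (g.1 1 1 : ℂ)) = 0 then OnePoint.infty
      else ((mobiusC g w : ℂ) : OnePoint ℂ) := rfl

/-- The Möbius action on the point of the real projective line with homogeneous coordinates `p`. -/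
theorem mobiusS_div (g : SL2) {p : Fin 2 → ℝ} (hp : p 1 ≠ 0) :
    mobiusS g (((p 0 / p 1 : ℝ) : ℂ) : OnePoint ℂ) =
      if planeAct g p 1 = 0 then OnePoint.infty
      else (((planeAct g p 0 / planeAct g p 1 : ℝ) : ℂ) : OnePoint ℂ) := by
  have h1 : (g.1 1 0 : ℂ) * ((p 0 / p 1 : ℝ) : ℂ) + (g.1 1 1 : ℂ) =
      ((planeAct g p 1 / p 1 : ℝ) : ℂ) := by
    rw [planeAct_one']; push_cast
    have : (p 1 : ℂ) ≠ 0 := by exact_mod_cast hp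
    field_simp
  have h0 : (g.1 0 0 : ℂ) * ((p 0 / p 1 : ℝ) : ℂ) + (g.1 0 1 : ℂ) =
      ((planeAct g p 0 / p 1 : ℝ) : ℂ) := by
    rw [planeAct_zero]; push_cast
    have : (p 1 : ℂ) ≠ 0 := by exact_mod_cast hp
    field_simp
  rw [mobiusS_coe, h1]
  by_cases h : planeAct g p 1 = 0
  · simp [h]
  · rw [if_neg h, if_neg (by rw [Complex.ofReal_eq_zero]; exact div_ne_zero h hp)]
    congr 1
    rw [mobiusC, h0, h1, ← Complex.ofReal_div]
    congr 1
    field_simp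

theorem mobiusR_eq (g : SL2) (x : ℝ) :
    mobiusR g x = planeAct g ![x, 1] 0 / planeAct g ![x, 1] 1 := by
  simp [mobiusR, planeAct_zero, planeAct_one']

namespace Schottky

variable (S : Schottky)

/-- The point with homogeneous coordinates `p` lies in the disc `D_a`. -/
def Inner (a : Fin (2 * S.r)) (p : Fin 2 → ℝ) : Prop :=
  |p 0 - S.center a * p 1| < S.radius a * |p 1|

/-- The point with homogeneous coordinates `p` lies outside the closure of the disc `D_a`. -/
def Outer (a : Fin (2 * S.r)) (p : Fin 2 → ℝ) : Prop :=
  S.radius a * |p 1| < |p 0 - S.center a * p 1|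

variable {S}

theorem Inner.ne_zero {a : Fin (2 * S.r)} {p : Fin 2 → ℝ} (h : S.Inner a p) : p 1 ≠ 0 := by
  intro h0
  simp only [Inner, h0] at h
  simp at h
  exact absurd h (not_lt.2 (abs_nonneg _))

theorem Inner.smul {a : Fin (2 * S.r)} {p : Fin 2 → ℝ} (h : S.Inner a p) {c : ℝ} (hc : c ≠ 0) :
    S.Inner a (c • p) := by
  have h1 : (c • p) 0 - S.center a * (c • p) 1 = c * (p 0 - S.center a * p 1) := by
    simp; ring
  have h2 : S.radius a * |(c • p) 1| = |c| * (S.radius a * |p 1|) := by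
    simp [abs_mul]; ring
  rw [Inner, h1, h2, abs_mul]
  exact mul_lt_mul_of_pos_left h (abs_pos.2 hc)

variable (S)

theorem centers_far {a b : Fin (2 * S.r)} (hab : a ≠ b) :
    S.radius a + S.radius b < |S.center a - S.center b| := by
  have h := S.disjoint a b hab
  rw [closure_ball _ (S.radius_pos a).ne', closure_ball _ (S.radius_pos b).ne',
    disjoint_closedBall_closedBall_iff (S.radius_pos a).le (S.radius_pos b).le] at h
  rwa [Complex.dist_eq, ← Complex.ofReal_sub, Complex.norm_real, Real.norm_eq_abs] at h

theorem outer_of_le {a b : Fin (2 * S.r)} (hab : a ≠ b) {p : Fin 2 → ℝ} (hp : p 1 ≠ 0)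
    (h : |p 0 - S.center a * p 1| ≤ S.radius a * |p 1|) : S.Outer b p := by
  have h1 := mul_lt_mul_of_pos_right (S.centers_far hab) (abs_pos.2 hp)
  rw [← abs_mul] at h1
  have h2 : |(S.center a - S.center b) * p 1| ≤
      |p 0 - S.center a * p 1| + |p 0 - S.center b * p 1| := by
    have : (S.center a - S.center b) * p 1 =
      (p 0 - S.center b * p 1) - (p 0 - S.center a * p 1) := by ring
    rw [this, add_comm]
    exact abs_sub _ _
  rw [Outer]
  linarith

variable {S}

theorem Inner.outer {a b : Fin (2 * S.r)} {p : Fin 2 → ℝ} (h : S.Inner a p) (hab : a ≠ b) :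
    S.Outer b p := S.outer_of_le hab h.ne_zero h.le

theorem Inner.eq {a b : Fin (2 * S.r)} {p : Fin 2 → ℝ} (h : S.Inner a p) (h' : S.Inner b p) :
    a = b := by
  by_contra hab
  exact lt_asymm (h.outer hab) h'

variable (S)

theorem outer_infty (a : Fin (2 * S.r)) : S.Outer a ![1, 0] := by
  simp [Outer]

theorem act_le (a : Fin (2 * S.r)) {p : Fin 2 → ℝ} (hp : p ≠ 0)
    (h : S.radius (wordBar a) * |p 1| ≤ |p 0 - S.center (wordBar a) * p 1|) :
    |planeAct (S.g a) p 0 - S.center a * planeAct (S.g a) p 1| ≤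
      S.radius a * |planeAct (S.g a) p 1| := by
  have hmaps := S.maps a
  rw [closure_ball _ (S.radius_pos a).ne'] at hmaps
  have key : ∀ z : OnePoint ℂ, z ∉ (fun w : ℂ => (w : OnePoint ℂ)) ''
      Metric.ball ((S.center (wordBar a) : ℂ)) (S.radius (wordBar a)) →
      ∃ w : ℂ, ‖w - S.center a‖ ≤ S.radius a ∧ mobiusS (S.g a) z = w := by
    intro z hz
    have : mobiusS (S.g a) z ∈ (fun w : ℂ => (w : OnePoint ℂ)) ''
        Metric.closedBall ((S.center a : ℂ)) (S.radius a) := by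
      rw [← hmaps]; exact Set.mem_image_of_mem _ hz
    obtain ⟨w, hw, hw'⟩ := this
    exact ⟨w, by rwa [← dist_eq_norm], hw'.symm⟩
  have fin : ∀ u v : ℝ, ‖((u / v : ℝ) : ℂ) - S.center a‖ ≤ S.radius a → v ≠ 0 →
      |u - S.center a * v| ≤ S.radius a * |v| := by
    intro u v huv hv
    rw [← Complex.ofReal_sub, Complex.norm_real, Real.norm_eq_abs] at huv
    have : u - S.center a * v = (u / v - S.center a) * v := by field_simp
    rw [this, abs_mul]
    exact mul_le_mul_of_nonneg_right huv (abs_nonneg v)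
  by_cases h1 : p 1 = 0
  · have h0 : p 0 ≠ 0 := by
      intro h0; apply hp; ext i; fin_cases i <;> simp [h0, h1]
    obtain ⟨w, hw, hw'⟩ := key OnePoint.infty (by simp)
    rw [mobiusS_infty] at hw'
    split_ifs at hw' with hC
    · exact absurd hw' (by simp)
    · rw [OnePoint.coe_eq_coe] at hw'
      rw [planeAct_zero, planeAct_one', h1, mul_zero, mul_zero, add_zero, add_zero]
      refine fin _ _ ?_ (mul_ne_zero hC h0)
      rw [mul_div_mul_right _ _ h0, hw']
      exact hw
  · obtain ⟨w, hw, hw'⟩ := key (((p 0 / p 1 : ℝ) : ℂ) : OnePoint ℂ) (by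
      rintro ⟨w, hw, hw'⟩
      rw [OnePoint.coe_eq_coe] at hw'
      subst hw'
      rw [Metric.mem_ball, dist_eq_norm, ← Complex.ofReal_sub, Complex.norm_real,
        Real.norm_eq_abs] at hw
      have := mul_lt_mul_of_pos_right hw (abs_pos.2 h1)
      rw [← abs_mul, sub_mul, div_mul_cancel₀ _ h1] at this
      linarith)
    rw [mobiusS_div _ h1] at hw'
    split_ifs at hw' with hC
    · exact absurd hw' (by simp)
    · rw [OnePoint.coe_eq_coe] at hw'
      refine fin _ _ ?_ hC
      rw [hw']; exact hw

theorem act_inner {a : Fin (2 * S.r)} {p : Fin 2 → ℝ} (h : S.Outer (wordBar a) p) :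
    S.Inner a (planeAct (S.g a) p) := by
  by_contra hcon
  rw [Inner, not_lt] at hcon
  have hp : p ≠ 0 := by
    rintro rfl
    simp [Outer] at h
  have := S.act_le (wordBar a) (planeAct_ne_zero (S.g a) hp) (by rwa [wordBar_wordBar])
  rw [S.g_bar, inv_planeAct_planeAct] at this
  exact absurd this (not_le.2 h)

/-- The homogeneous coordinates `p` are outside the closed disc forbidden by the last letter of
`u`. -/
def Admissible (u : List (Fin (2 * S.r))) (p : Fin 2 → ℝ) : Prop :=
  ∀ z ∈ u.getLast?, S.Outer (wordBar z) p

theorem wprod_cons (a : Fin (2 * S.r)) (u : List (Fin (2 * S.r))) :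
    S.wprod (a :: u) = S.g a * S.wprod u := by simp [wprod]

theorem wprod_append (u v : List (Fin (2 * S.r))) :
    S.wprod (u ++ v) = S.wprod u * S.wprod v := by simp [wprod]

theorem wprod_nil : S.wprod [] = 1 := rfl

variable {S}

theorem Admissible.tail {a : Fin (2 * S.r)} {u : List (Fin (2 * S.r))} {p : Fin 2 → ℝ}
    (h : S.Admissible (a :: u) p) : S.Admissible u p := by
  intro z hz
  refine h z ?_
  rw [List.getLast?_cons]
  rw [Option.mem_def] at hz
  simp [hz]

variable (S)

theorem wprod_inner {a : Fin (2 * S.r)} {u : List (Fin (2 * S.r))} (hu : IsWord (a :: u))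
    {p : Fin 2 → ℝ} (hp : S.Admissible (a :: u) p) :
    S.Inner a (planeAct (S.wprod (a :: u)) p) := by
  induction u generalizing a with
  | nil =>
    rw [wprod_cons, wprod_nil, mul_one]
    exact S.act_inner (hp a (by simp))
  | cons b t ih =>
    have h1 := ih (a := b) (List.IsChain.tail hu) hp.tail
    rw [wprod_cons, mul_planeAct]
    refine S.act_inner (h1.outer ?_)
    have : a ≠ wordBar b := by
      rw [IsWord, List.Chain', List.isChain_cons_cons] at hu
      exact hu.1
    intro h; exact this (by rw [h, wordBar_wordBar])

theorem prefix_of_smul_eq {u v : List (Fin (2 * S.r))} (hu : IsWord u) (hv : IsWord v)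
    {p q : Fin 2 → ℝ} (hp : S.Admissible u p) (hq : S.Admissible v q) {c : ℝ} (hc : c ≠ 0)
    (h : planeAct (S.wprod u) p = c • planeAct (S.wprod v) q) : u <+: v ∨ v <+: u := by
  induction u generalizing v with
  | nil => exact Or.inl List.nil_prefix
  | cons a u ih =>
    cases v with
    | nil => exact Or.inr List.nil_prefix
    | cons b v =>
      have h1 := S.wprod_inner hu hp
      rw [h] at h1
      obtain rfl := h1.eq ((S.wprod_inner hv hq).smul hc)
      rw [wprod_cons, wprod_cons, mul_planeAct, mul_planeAct, ← planeAct_smul] at h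
      have h2 := congrArg (planeAct (S.g a)⁻¹) h
      rw [inv_planeAct_planeAct, inv_planeAct_planeAct] at h2
      rcases ih (List.IsChain.tail hu) (List.IsChain.tail hv) hp.tail hq.tail h2 with h3 | h3
      · exact Or.inl (List.cons_prefix_cons.2 ⟨rfl, h3⟩)
      · exact Or.inr (List.cons_prefix_cons.2 ⟨rfl, h3⟩)

theorem wprod_injective {u v : List (Fin (2 * S.r))} (hu : IsWord u) (hv : IsWord v)
    (h : S.wprod u = S.wprod v) : u = v := by
  induction u generalizing v with
  | nil =>
    cases v with
    | nil => rfl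
    | cons b v =>
      have := (S.wprod_inner hv (p := ![1, 0]) fun z _ => S.outer_infty _).ne_zero
      rw [← h, wprod_nil, one_planeAct] at this
      simp at this
  | cons a u ih =>
    have h1 := S.wprod_inner hu (p := ![1, 0]) fun z _ => S.outer_infty _
    cases v with
    | nil =>
      have := h1.ne_zero
      rw [h, wprod_nil, one_planeAct] at this
      simp at this
    | cons b v =>
      have h2 := S.wprod_inner hv (p := ![1, 0]) fun z _ => S.outer_infty _
      rw [h] at h1
      obtain rfl := h1.eq h2
      rw [wprod_cons, wprod_cons] at h
      exact congrArg _ (ih (v := v) (List.IsChain.tail hu) (List.IsChain.tail hv)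
        (mul_left_cancel h))

end Schottky

/-- The size of the bottom row of a matrix. -/
noncomputable def rowSize (g : SL2) : ℝ := |g.1 1 0| + |g.1 1 1|

/-- The denominator of a Möbius transformation. -/
noncomputable def denomR (g : SL2) (x : ℝ) : ℝ := g.1 1 0 * x + g.1 1 1

theorem det_eq (g : SL2) : g.1 0 0 * g.1 1 1 - g.1 0 1 * g.1 1 0 = 1 := by
  have := g.2
  rwa [Matrix.det_fin_two] at this

theorem rowSize_pos (g : SL2) : 0 < rowSize g := by
  by_contra h
  have h1 : |g.1 1 0| = 0 := by
    apply le_antisymm _ (abs_nonneg _)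
    unfold rowSize at h
    linarith [abs_nonneg (g.1 1 1)]
  have h2 : |g.1 1 1| = 0 := by
    apply le_antisymm _ (abs_nonneg _)
    unfold rowSize at h
    linarith [abs_nonneg (g.1 1 0)]
  have := det_eq g
  rw [abs_eq_zero.1 h1, abs_eq_zero.1 h2] at this
  simp at this

theorem rowSize_one : rowSize 1 = 1 := by simp [rowSize]

theorem rowSize_mul_le (g h : SL2) :
    rowSize (g * h) ≤ (|h.1 0 0| + |h.1 0 1| + |h.1 1 0| + |h.1 1 1|) * rowSize g := by
  have h1 : (g * h).1 1 0 = g.1 1 0 * h.1 0 0 + g.1 1 1 * h.1 1 0 := by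
    simp [Matrix.mul_apply, Fin.sum_univ_two]
  have h2 : (g * h).1 1 1 = g.1 1 0 * h.1 0 1 + g.1 1 1 * h.1 1 1 := by
    simp [Matrix.mul_apply, Fin.sum_univ_two]
  unfold rowSize
  rw [h1, h2]
  have e1 := abs_add_le (g.1 1 0 * h.1 0 0) (g.1 1 1 * h.1 1 0)
  have e2 := abs_add_le (g.1 1 0 * h.1 0 1) (g.1 1 1 * h.1 1 1)
  simp only [abs_mul] at e1 e2
  have := abs_nonneg (g.1 1 0)
  have := abs_nonneg (g.1 1 1)
  have := abs_nonneg (h.1 0 0)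
  have := abs_nonneg (h.1 0 1)
  have := abs_nonneg (h.1 1 0)
  have := abs_nonneg (h.1 1 1)
  nlinarith [mul_nonneg ‹0 ≤ |g.1 1 0|› ‹0 ≤ |h.1 1 0|›, mul_nonneg ‹0 ≤ |g.1 1 0|› ‹0 ≤ |h.1 1 1|›,
    mul_nonneg ‹0 ≤ |g.1 1 1|› ‹0 ≤ |h.1 0 0|›, mul_nonneg ‹0 ≤ |g.1 1 1|› ‹0 ≤ |h.1 0 1|›]

theorem mobiusR_sub (g : SL2) {x y : ℝ} (hx : denomR g x ≠ 0) (hy : denomR g y ≠ 0) :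
    mobiusR g x - mobiusR g y = (x - y) / (denomR g x * denomR g y) := by
  have := det_eq g
  unfold mobiusR
  unfold denomR at *
  rw [div_sub_div _ _ hx hy]
  congr 1
  linear_combination (x - y) * this

theorem mobiusR_mul (g h : SL2) {x : ℝ} (hx : denomR h x ≠ 0) :
    mobiusR (g * h) x = mobiusR g (mobiusR h x) := by
  have e : ∀ i j, (g * h).1 i j = g.1 i 0 * h.1 0 j + g.1 i 1 * h.1 1 j := fun i j => by
    simp [Matrix.mul_apply, Fin.sum_univ_two]
  unfold mobiusR
  simp only [e]
  unfold denomR at hx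
  set n := h.1 0 0 * x + h.1 0 1 with hn
  set q := h.1 1 0 * x + h.1 1 1 with hq
  have e1 : g.1 0 0 * (n / q) + g.1 0 1 = (g.1 0 0 * n + g.1 0 1 * q) / q := by field_simp
  have e2 : g.1 1 0 * (n / q) + g.1 1 1 = (g.1 1 0 * n + g.1 1 1 * q) / q := by field_simp
  rw [e1, e2, div_div_div_cancel_right₀ hx]
  congr 1 <;> rw [hn, hq] <;> ring

theorem planeAct_vec_one (g : SL2) (x : ℝ) : planeAct g ![x, 1] 1 = denomR g x := by
  simp [planeAct_one', denomR]

section Mirror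

variable {r : ℕ}

theorem isWord_mirror {w : List (Fin (2 * r))} (hw : IsWord w) : IsWord (mirror w) := by
  rw [IsWord, List.Chain', List.isChain_iff_getElem] at *
  intro i hi
  simp only [mirror, List.length_reverse, List.length_map] at hi
  simp only [mirror, List.getElem_reverse, List.getElem_map, List.length_map, wordBar_wordBar]
  intro h
  have := hw (w.length - 1 - (i + 1)) (by omega)
  apply this
  have e : w.length - 1 - (i + 1) + 1 = w.length - 1 - i := by omega
  simp only [e]
  exact h.symm

theorem mirror_mirror (w : List (Fin (2 * r))) : mirror (mirror w) = w := by
  simp [mirror, Function.comp_def, wordBar_wordBar]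

theorem length_mirror (w : List (Fin (2 * r))) : (mirror w).length = w.length := by
  simp [mirror]

theorem IsWord.left {u v : List (Fin (2 * r))} (h : IsWord (u ++ v)) : IsWord u :=
  List.IsChain.left_of_append h

theorem IsWord.right {u v : List (Fin (2 * r))} (h : IsWord (u ++ v)) : IsWord v :=
  List.IsChain.right_of_append h

theorem isWord_append {u v : List (Fin (2 * r))} :
    IsWord (u ++ v) ↔ IsWord u ∧ IsWord v ∧ arrow u v := List.isChain_append

end Mirror

theorem exists_pos_le {ι : Type} [Finite ι] (f : ι → ℝ) (hf : ∀ i, 0 < f i) :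
    ∃ c > 0, ∀ i, c ≤ f i := by
  rcases isEmpty_or_nonempty ι with h | h
  · exact ⟨1, one_pos, fun i => (h.false i).elim⟩
  · obtain ⟨i, hi⟩ := Finite.exists_min f
    exact ⟨f i, hf i, hi⟩

theorem exists_le_bound {ι : Type} [Finite ι] (f : ι → ℝ) : ∃ c, 1 ≤ c ∧ ∀ i, f i ≤ c := by
  obtain ⟨c, hc⟩ := (Set.finite_range f).bddAbove
  exact ⟨max c 1, le_max_right _ _, fun i => (hc ⟨i, rfl⟩).trans (le_max_left _ _)⟩

namespace Schottky

variable (S : Schottky)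

theorem wprod_mirror (w : List (Fin (2 * S.r))) : S.wprod (mirror w) = (S.wprod w)⁻¹ :=
  prod_mirror S.g S.g_bar w

theorem mem_Ireal {a : Fin (2 * S.r)} {x : ℝ} : x ∈ S.Ireal a ↔ |x - S.center a| < S.radius a := by
  rw [Ireal, Set.mem_ofPred_eq, D, Metric.mem_ball, Complex.dist_eq, ← Complex.ofReal_sub,
    Complex.norm_real, Real.norm_eq_abs]

theorem Ireal_eq (a : Fin (2 * S.r)) :
    S.Ireal a = Set.Ioo (S.center a - S.radius a) (S.center a + S.radius a) := by
  ext x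
  rw [mem_Ireal, abs_lt, Set.mem_Ioo]
  constructor <;> rintro ⟨h1, h2⟩ <;> constructor <;> linarith

/-- The closure of the interval `I_a`. -/
def Iclosed (a : Fin (2 * S.r)) : Set ℝ :=
  Set.Icc (S.center a - S.radius a) (S.center a + S.radius a)

theorem mem_Iclosed {a : Fin (2 * S.r)} {x : ℝ} :
    x ∈ S.Iclosed a ↔ |x - S.center a| ≤ S.radius a := by
  rw [Iclosed, abs_le, Set.mem_Icc]
  constructor <;> rintro ⟨h1, h2⟩ <;> constructor <;> linarith

theorem admissible_of_mem {v : List (Fin (2 * S.r))} {a : Fin (2 * S.r)}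
    (hv : IsWord (v ++ [a])) {x : ℝ} (hx : x ∈ S.Iclosed a) : S.Admissible v ![x, 1] := by
  intro z hz
  refine S.outer_of_le (a := a) ?_ (by simp) ?_
  · have := (isWord_append.1 hv).2.2 z hz a (by simp)
    intro h; exact this (by rw [h, wordBar_wordBar])
  · simpa using S.mem_Iclosed.1 hx

/-- The pole of `γ_v` lies in the disc paired with the last letter of `v`. -/
theorem inner_pole {v : List (Fin (2 * S.r))} (hv : IsWord v) {z : Fin (2 * S.r)}
    (hz : z ∈ v.getLast?) :
    S.Inner (wordBar z) ![(S.wprod v).1 1 1, -(S.wprod v).1 1 0] := by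
  have h1 : (mirror v).head? = some (wordBar z) := by
    rw [mirror, List.head?_reverse, List.getLast?_map, hz]; rfl
  obtain ⟨t, ht⟩ : ∃ t, mirror v = wordBar z :: t := by
    cases hm : mirror v with
    | nil => rw [hm] at h1; simp at h1
    | cons b t => rw [hm] at h1; simp at h1; exact ⟨t, by rw [h1]⟩
  have h2 := isWord_mirror hv
  rw [ht] at h2
  have h3 := S.wprod_inner h2 (p := ![1, 0]) fun z _ => S.outer_infty _
  rw [← ht, wprod_mirror] at h3
  convert h3 using 1
  ext i
  fin_cases i
  · change (S.wprod v).1 1 1 = planeAct (S.wprod v)⁻¹ ![1, 0] 0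
    rw [planeAct_zero, Matrix.SpecialLinearGroup.SL2_inv_expl]
    simp
  · change -(S.wprod v).1 1 0 = planeAct (S.wprod v)⁻¹ ![1, 0] 1
    rw [planeAct_one', Matrix.SpecialLinearGroup.SL2_inv_expl]
    simp

theorem exists_bound : ∃ X : ℝ, 1 ≤ X ∧ ∀ a, |S.center a| + S.radius a ≤ X := exists_le_bound _

theorem exists_gap : ∃ d > 0, ∀ a b, a ≠ b →
    S.radius a + S.radius b + d ≤ |S.center a - S.center b| := by
  obtain ⟨d, hd, h⟩ := exists_pos_le
    (fun x : {x : Fin (2 * S.r) × Fin (2 * S.r) // x.1 ≠ x.2} =>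
      |S.center x.1.1 - S.center x.1.2| - (S.radius x.1.1 + S.radius x.1.2))
    (fun x => sub_pos.2 (S.centers_far x.2))
  exact ⟨d, hd, fun a b hab => by have := h ⟨(a, b), hab⟩; simp only at this; linarith⟩

theorem abs_le_of_mem {X : ℝ} (hX : ∀ a, |S.center a| + S.radius a ≤ X) {a : Fin (2 * S.r)} {x : ℝ}
    (hx : x ∈ S.Iclosed a) : |x| ≤ X := by
  have h1 := S.mem_Iclosed.1 hx
  have h2 := abs_add_le (x - S.center a) (S.center a)
  rw [sub_add_cancel] at h2
  linarith [hX a]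

/-- Bounded distortion. -/
theorem exists_distortion : ∃ d > 0, ∃ R : ℝ, 1 ≤ R ∧ ∀ (v : List (Fin (2 * S.r)))
    (a : Fin (2 * S.r)), IsWord (v ++ [a]) → ∀ x ∈ S.Iclosed a,
      d * rowSize (S.wprod v) ≤ |denomR (S.wprod v) x| ∧
      |denomR (S.wprod v) x| ≤ R * rowSize (S.wprod v) := by
  obtain ⟨X, hX1, hX⟩ := S.exists_bound
  obtain ⟨d, hd, hgap⟩ := S.exists_gap
  refine ⟨min d 1 / (1 + X), by positivity, X, hX1, fun v a hv x hx => ⟨?_, ?_⟩⟩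
  · rcases List.eq_nil_or_concat v with rfl | ⟨t, z, rfl⟩
    · rw [wprod_nil, rowSize_one]
      simp only [denomR, Matrix.SpecialLinearGroup.coe_one, Matrix.one_apply_eq]
      rw [Matrix.one_apply_ne (by decide), zero_mul, zero_add, abs_one, mul_one,
        div_le_one (by positivity)]
      linarith [min_le_right d 1]
    · have hz : z ∈ (t.concat z).getLast? := by simp
      have h1 := S.inner_pole hv.left hz
      set g := S.wprod (t.concat z)
      simp only [Inner, Matrix.cons_val_zero, Matrix.cons_val_one] at h1
      rw [mul_neg, sub_neg_eq_add, abs_neg] at h1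
      have hne : wordBar z ≠ a := by
        have := (isWord_append.1 hv).2.2 z hz a (by simp)
        intro h; exact this (by rw [← h, wordBar_wordBar])
      have h2 := hgap _ _ hne
      have h3 := S.mem_Iclosed.1 hx
      set b := wordBar z
      have hC := abs_nonneg (g.1 1 0)
      have h4 : |S.center b - S.center a| * |g.1 1 0| ≤
          |denomR g x| + |g.1 1 1 + S.center b * g.1 1 0| + |x - S.center a| * |g.1 1 0| := by
        rw [← abs_mul, ← abs_mul]
        have : (S.center b - S.center a) * g.1 1 0 = -denomR g x +
          (g.1 1 1 + S.center b * g.1 1 0) + (x - S.center a) * g.1 1 0 := by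
          unfold denomR; ring
        rw [this]
        refine (abs_add_le _ _).trans ?_
        gcongr
        refine (abs_add_le _ _).trans ?_
        rw [abs_neg]
      have h5 : d * |g.1 1 0| ≤ |denomR g x| := by
        have e1 := mul_le_mul_of_nonneg_right h2 hC
        have e2 := mul_le_mul_of_nonneg_right h3 hC
        nlinarith
      have h6 : |g.1 1 1| ≤ X * |g.1 1 0| := by
        have e1 := abs_sub (g.1 1 1 + S.center b * g.1 1 0) (S.center b * g.1 1 0)
        rw [add_sub_cancel_right, abs_mul] at e1
        have e2 := mul_le_mul_of_nonneg_right (hX b) hC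
        nlinarith
      rw [div_mul_eq_mul_div, div_le_iff₀ (by positivity)]
      calc min d 1 * rowSize g ≤ d * rowSize g := by
            gcongr
            · exact (rowSize_pos g).le
            · exact min_le_left _ _
        _ ≤ d * ((1 + X) * |g.1 1 0|) := by
            gcongr; unfold rowSize; linarith
        _ = (d * |g.1 1 0|) * (1 + X) := by ring
        _ ≤ _ := by gcongr
  · have h1 := S.abs_le_of_mem hX hx
    unfold denomR rowSize
    refine (abs_add_le _ _).trans ?_
    rw [abs_mul, mul_add]
    have := abs_nonneg ((S.wprod v).1 1 0)
    have := abs_nonneg ((S.wprod v).1 1 1)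
    nlinarith

theorem denomR_ne_zero {v : List (Fin (2 * S.r))} {a : Fin (2 * S.r)} (hv : IsWord (v ++ [a]))
    {x : ℝ} (hx : x ∈ S.Iclosed a) : denomR (S.wprod v) x ≠ 0 := by
  obtain ⟨d, hd, R, -, h⟩ := S.exists_distortion
  have h1 := (h v a hv x hx).1
  exact abs_pos.1 (lt_of_lt_of_le (mul_pos hd (rowSize_pos _)) h1)

theorem denomR_mul_pos {v : List (Fin (2 * S.r))} {a : Fin (2 * S.r)} (hv : IsWord (v ++ [a]))
    {x y : ℝ} (hx : x ∈ S.Iclosed a) (hy : y ∈ S.Iclosed a) :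
    0 < denomR (S.wprod v) x * denomR (S.wprod v) y := by
  by_contra hcon
  have h0 : (0 : ℝ) ∈ Set.uIcc (denomR (S.wprod v) x) (denomR (S.wprod v) y) := by
    rw [Set.mem_uIcc]
    rcases mul_nonpos_iff.1 (not_lt.1 hcon) with h | h
    · exact Or.inr ⟨h.2, h.1⟩
    · exact Or.inl ⟨h.1, h.2⟩
  have hcont : ContinuousOn (denomR (S.wprod v)) (Set.uIcc x y) := by
    unfold denomR; fun_prop
  obtain ⟨z, hz, hz0⟩ := intermediate_value_uIcc hcont h0
  exact S.denomR_ne_zero hv (Set.uIcc_subset_Icc hx hy hz) hz0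

theorem left_mem_Iclosed (a : Fin (2 * S.r)) : S.center a - S.radius a ∈ S.Iclosed a :=
  Set.left_mem_Icc.2 (by linarith [S.radius_pos a])

theorem right_mem_Iclosed (a : Fin (2 * S.r)) : S.center a + S.radius a ∈ S.Iclosed a :=
  Set.right_mem_Icc.2 (by linarith [S.radius_pos a])

theorem strictMonoOn_mobiusR {v : List (Fin (2 * S.r))} {a : Fin (2 * S.r)}
    (hv : IsWord (v ++ [a])) : StrictMonoOn (mobiusR (S.wprod v)) (S.Iclosed a) := by
  intro x hx y hy hxy
  rw [← sub_pos, mobiusR_sub _ (S.denomR_ne_zero hv hy) (S.denomR_ne_zero hv hx)]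
  exact div_pos (sub_pos.2 hxy) (S.denomR_mul_pos hv hy hx)

theorem continuousOn_mobiusR {v : List (Fin (2 * S.r))} {a : Fin (2 * S.r)}
    (hv : IsWord (v ++ [a])) : ContinuousOn (mobiusR (S.wprod v)) (S.Iclosed a) := by
  unfold mobiusR
  refine ContinuousOn.div (by fun_prop) (by fun_prop) fun x hx => S.denomR_ne_zero hv hx

theorem Iset_append (v : List (Fin (2 * S.r))) (a : Fin (2 * S.r)) :
    S.Iset (v ++ [a]) = mobiusR (S.wprod v) '' S.Ireal a := by
  simp [Iset]

theorem Iset_eq_Ioo {v : List (Fin (2 * S.r))} {a : Fin (2 * S.r)} (hv : IsWord (v ++ [a])) :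
    S.Iset (v ++ [a]) = Set.Ioo (mobiusR (S.wprod v) (S.center a - S.radius a))
      (mobiusR (S.wprod v) (S.center a + S.radius a)) := by
  rw [Iset_append, Ireal_eq]
  apply Set.Subset.antisymm
  · rintro _ ⟨x, hx, rfl⟩
    have hm := S.strictMonoOn_mobiusR hv
    exact ⟨hm (S.left_mem_Iclosed a) (Set.Ioo_subset_Icc_self hx) hx.1,
      hm (Set.Ioo_subset_Icc_self hx) (S.right_mem_Iclosed a) hx.2⟩
  · exact intermediate_value_Ioo (by linarith [S.radius_pos a]) (S.continuousOn_mobiusR hv)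

theorem ups_append {v : List (Fin (2 * S.r))} {a : Fin (2 * S.r)} (hv : IsWord (v ++ [a])) :
    S.ups (v ++ [a]) = 2 * S.radius a / (denomR (S.wprod v) (S.center a + S.radius a) *
      denomR (S.wprod v) (S.center a - S.radius a)) := by
  have h := mobiusR_sub (S.wprod v) (S.denomR_ne_zero hv (S.right_mem_Iclosed a))
    (S.denomR_ne_zero hv (S.left_mem_Iclosed a))
  rw [ups, if_neg (by simp), S.Iset_eq_Ioo hv, Real.volume_Ioo, h, ENNReal.toReal_ofReal]
  · congr 1; ring
  · rw [← h, sub_nonneg]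
    exact ((S.strictMonoOn_mobiusR hv).monotoneOn (S.left_mem_Iclosed a) (S.right_mem_Iclosed a)
      (by linarith [S.radius_pos a]))

theorem exists_ups_bounds : ∃ k₁ > 0, ∃ k₂ > 0, ∀ (v : List (Fin (2 * S.r)))
    (a : Fin (2 * S.r)), IsWord (v ++ [a]) →
      k₁ / rowSize (S.wprod v) ^ 2 ≤ S.ups (v ++ [a]) ∧
      S.ups (v ++ [a]) ≤ k₂ / rowSize (S.wprod v) ^ 2 := by
  obtain ⟨d, hd, R, hR, h⟩ := S.exists_distortion
  obtain ⟨ρ, hρ, hrad⟩ := exists_pos_le S.radius S.radius_pos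
  obtain ⟨X, hX1, hX⟩ := S.exists_bound
  refine ⟨2 * ρ / R ^ 2, by positivity, 2 * X / d ^ 2, by positivity, fun v a hv => ?_⟩
  have hN := rowSize_pos (S.wprod v)
  set N := rowSize (S.wprod v)
  have hr := h v a hv _ (S.right_mem_Iclosed a)
  have hl := h v a hv _ (S.left_mem_Iclosed a)
  have hpos := S.denomR_mul_pos hv (S.right_mem_Iclosed a) (S.left_mem_Iclosed a)
  rw [S.ups_append hv, div_div, div_div, ← abs_of_pos hpos, abs_mul, ← mul_pow, ← mul_pow]
  replace hpos := abs_pos.2 hpos.ne'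
  rw [abs_mul] at hpos
  have hrX : S.radius a ≤ X := le_trans (by linarith [abs_nonneg (S.center a)]) (hX a)
  have := S.radius_pos a
  constructor
  · apply div_le_div₀ (by positivity) _ hpos
    · rw [sq]; exact mul_le_mul hr.2 hl.2 (abs_nonneg _) (by positivity)
    · linarith [hrad a]
  · apply div_le_div₀ (by positivity) (by linarith) (by positivity)
    rw [sq]; exact mul_le_mul hr.1 hl.1 (by positivity) (abs_nonneg _)

theorem exists_rowSize_mul_le : ∃ K : ℝ, 1 ≤ K ∧ ∀ (v : List (Fin (2 * S.r))) (a : Fin (2 * S.r)),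
    rowSize (S.wprod (v ++ [a])) ≤ K * rowSize (S.wprod v) := by
  obtain ⟨K, hK, h⟩ := exists_le_bound fun a : Fin (2 * S.r) =>
    |(S.g a).1 0 0| + |(S.g a).1 0 1| + |(S.g a).1 1 0| + |(S.g a).1 1 1|
  refine ⟨K, hK, fun v a => ?_⟩
  rw [wprod_append, wprod_cons, wprod_nil, mul_one]
  exact (rowSize_mul_le _ _).trans (mul_le_mul_of_nonneg_right (h a) (rowSize_pos _).le)

end Schottky

section Letters

variable {r : ℕ}

theorem exists_letter_ne (hr : 2 ≤ r) (p q : Fin (2 * r)) : ∃ c, c ≠ p ∧ c ≠ q := by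
  by_contra h
  push Not at h
  have h1 : (Finset.univ : Finset (Fin (2 * r))) ⊆ {p, q} := by
    intro c _
    by_cases hc : c = p
    · simp [hc]
    · simp [h c hc]
  have h2 := (Finset.card_le_card h1).trans Finset.card_le_two
  rw [Finset.card_univ, Fintype.card_fin] at h2
  omega

theorem isWord_concat {v : List (Fin (2 * r))} {a b : Fin (2 * r)} (hv : IsWord (v ++ [a]))
    (hab : a ≠ wordBar b) : IsWord (v ++ [a] ++ [b]) := by
  refine isWord_append.2 ⟨hv, List.isChain_singleton b, ?_⟩
  intro x hx y hy
  simp at hx hy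
  subst hx hy
  exact hab

end Letters

namespace Schottky

variable (S : Schottky)

theorem mobiusR_mem_Ireal {a b : Fin (2 * S.r)} {v : List (Fin (2 * S.r))}
    (hv : IsWord (a :: v ++ [b])) {x : ℝ} (hx : x ∈ S.Iclosed b) :
    mobiusR (S.wprod (a :: v)) x ∈ S.Ireal a := by
  have h1 := S.wprod_inner (a := a) (u := v) hv.left (S.admissible_of_mem hv hx)
  have h2 := h1.ne_zero
  rw [mem_Ireal, mobiusR_eq]
  rw [Inner] at h1
  set p := planeAct (S.wprod (a :: v)) ![x, 1]
  have : p 0 - S.center a * p 1 = (p 0 / p 1 - S.center a) * p 1 := by field_simp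
  rw [this, abs_mul] at h1
  exact lt_of_mul_lt_mul_right h1 (abs_nonneg _)

theorem Ireal_subset_Iclosed (a : Fin (2 * S.r)) : S.Ireal a ⊆ S.Iclosed a := fun _ hx =>
  S.mem_Iclosed.2 (S.mem_Ireal.1 hx).le

theorem isWord_pair {v : List (Fin (2 * S.r))} {a b : Fin (2 * S.r)}
    (h : IsWord (v ++ [a] ++ [b])) : IsWord ([a] ++ [b]) := by
  rw [List.append_assoc] at h
  exact h.right

theorem mobiusR_wprod_append {u v : List (Fin (2 * S.r))} {b : Fin (2 * S.r)}
    (hv : IsWord (v ++ [b])) {x : ℝ} (hx : x ∈ S.Iclosed b) :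
    mobiusR (S.wprod (u ++ v)) x = mobiusR (S.wprod u) (mobiusR (S.wprod v) x) := by
  rw [wprod_append, mobiusR_mul _ _ (S.denomR_ne_zero hv hx)]

theorem Iset_subset {v : List (Fin (2 * S.r))} {a b : Fin (2 * S.r)}
    (hv : IsWord (v ++ [a] ++ [b])) : S.Iset (v ++ [a] ++ [b]) ⊆ S.Iset (v ++ [a]) := by
  rw [Iset_append, Iset_append]
  rintro _ ⟨x, hx, rfl⟩
  have h1 := S.isWord_pair hv
  have hx' := S.Ireal_subset_Iclosed b hx
  rw [S.mobiusR_wprod_append h1 hx']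
  exact ⟨_, S.mobiusR_mem_Ireal (a := a) (v := []) h1 hx', rfl⟩

theorem Ireal_disjoint {a b : Fin (2 * S.r)} (hab : a ≠ b) {x : ℝ} (hx : x ∈ S.Iclosed a) :
    x ∉ S.Iclosed b := by
  rw [mem_Iclosed] at *
  intro h
  have h1 := S.centers_far hab
  have h2 := abs_sub (x - S.center b) (x - S.center a)
  rw [sub_sub_sub_cancel_left] at h2
  linarith

theorem Iset_disjoint {v : List (Fin (2 * S.r))} {b b' : Fin (2 * S.r)}
    (hv : IsWord (v ++ [b])) (hv' : IsWord (v ++ [b'])) (hb : b ≠ b') :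
    Disjoint (S.Iset (v ++ [b])) (S.Iset (v ++ [b'])) := by
  rw [Iset_append, Iset_append, Set.disjoint_left]
  rintro _ ⟨x, hx, rfl⟩ ⟨y, hy, hxy⟩
  have hx' := S.Ireal_subset_Iclosed b hx
  have hy' := S.Ireal_subset_Iclosed b' hy
  have h1 := S.denomR_ne_zero hv hx'
  have h2 := S.denomR_ne_zero hv' hy'
  rw [← sub_eq_zero, mobiusR_sub _ h2 h1, div_eq_zero_iff] at hxy
  rcases hxy with h | h
  · rw [sub_eq_zero] at h
    rw [h] at hy'
    exact S.Ireal_disjoint hb hx' hy'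
  · exact mul_ne_zero h2 h1 h

theorem ups_add_le {v : List (Fin (2 * S.r))} {a b b' : Fin (2 * S.r)}
    (hv : IsWord (v ++ [a] ++ [b])) (hv' : IsWord (v ++ [a] ++ [b'])) (hb : b ≠ b') :
    S.ups (v ++ [a] ++ [b]) + S.ups (v ++ [a] ++ [b']) ≤ S.ups (v ++ [a]) := by
  have e : ∀ u (c : Fin (2 * S.r)), S.ups (u ++ [c]) = (volume (S.Iset (u ++ [c]))).toReal :=
    fun u c => by rw [ups, if_neg (by simp)]
  have fin : ∀ u (c : Fin (2 * S.r)), IsWord (u ++ [c]) → volume (S.Iset (u ++ [c])) ≠ ⊤ := by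
    intro u c h
    rw [S.Iset_eq_Ioo h, Real.volume_Ioo]; exact ENNReal.ofReal_ne_top
  rw [e, e, e, ← ENNReal.toReal_add (fin _ _ hv) (fin _ _ hv'),
    ← measure_union (S.Iset_disjoint hv hv' hb) (by rw [S.Iset_eq_Ioo hv']; exact measurableSet_Ioo)]
  exact ENNReal.toReal_mono (fin _ _ hv.left)
    (measure_mono (Set.union_subset (S.Iset_subset hv) (S.Iset_subset hv')))

theorem exists_ups_decay : ∃ θ : ℝ, 0 < θ ∧ θ < 1 ∧ ∀ u t : List (Fin (2 * S.r)), u ≠ [] →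
    IsWord (u ++ t) → S.ups (u ++ t) ≤ θ ^ t.length * S.ups u := by
  obtain ⟨k₁, hk₁, k₂, hk₂, h⟩ := S.exists_ups_bounds
  refine ⟨k₂ / (k₁ + k₂), by positivity, by rw [div_lt_one (by positivity)]; linarith, ?_⟩
  intro u t hu
  induction t using List.reverseRecOn with
  | nil => intro _; simp
  | append_singleton t b ih =>
    intro hw
    rw [← List.append_assoc] at hw
    have ih' := ih hw.left
    obtain ⟨v, a, hva⟩ : ∃ v a, u ++ t = v ++ [a] := by
      rcases List.eq_nil_or_concat (u ++ t) with h0 | ⟨v, a, h0⟩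
      · simp at h0; exact absurd h0.1 hu
      · exact ⟨v, a, by rw [h0, List.concat_eq_append]⟩
    rw [← List.append_assoc]
    rw [hva] at hw ih' ⊢
    obtain ⟨b', hb1, hb2⟩ := exists_letter_ne S.two_le_r (wordBar a) b
    have hw' : IsWord (v ++ [a] ++ [b']) :=
      isWord_concat hw.left fun h => hb1 (by rw [h, wordBar_wordBar])
    have h1 := S.ups_add_le hw hw' hb2.symm
    have h2 := (h _ _ hw).2
    have h3 := (h _ _ hw').1
    have hN := rowSize_pos (S.wprod (v ++ [a]))
    set N := rowSize (S.wprod (v ++ [a])) ^ 2 with hNdef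
    have hN2 : 0 < N := by positivity
    have h4 : k₁ * S.ups (v ++ [a] ++ [b]) ≤ k₂ * S.ups (v ++ [a] ++ [b']) := by
      rw [le_div_iff₀ hN2] at h2
      rw [div_le_iff₀ hN2] at h3
      have e1 := mul_le_mul_of_nonneg_left h2 hk₁.le
      have e2 := mul_le_mul_of_nonneg_left h3 hk₂.le
      exact le_of_mul_le_mul_right (by nlinarith) hN2
    have h5 : S.ups (v ++ [a] ++ [b]) ≤ k₂ / (k₁ + k₂) * S.ups (v ++ [a]) := by
      rw [div_mul_eq_mul_div, le_div_iff₀ (by positivity)]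
      have := mul_le_mul_of_nonneg_left h1 hk₂.le
      nlinarith
    refine h5.trans ?_
    rw [List.length_append, List.length_singleton, pow_succ']
    rw [mul_assoc]
    exact mul_le_mul_of_nonneg_left ih' (by positivity)

theorem ups_nonneg (w : List (Fin (2 * S.r))) : 0 ≤ S.ups w := by
  unfold ups; split_ifs <;> positivity

theorem eq_of_prefix_of_mem_Zset {τ : ℝ} {u v : List (Fin (2 * S.r))} (hu : u ∈ S.Zset τ)
    (hv : v ∈ S.Zset τ) (h : u <+: v) : u = v := by
  obtain ⟨t, rfl⟩ := h
  rcases List.eq_nil_or_concat t with rfl | ⟨t, z, rfl⟩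
  · simp
  exfalso
  obtain ⟨θ, h0, h1, hθ⟩ := S.exists_ups_decay
  have hv4 := hv.2.2.2
  have hw := hv.1
  rw [List.concat_eq_append, ← List.append_assoc] at hv4 hw
  rw [List.dropLast_concat] at hv4
  have := hθ u t hu.2.1 hw.left
  have h2 : θ ^ t.length * S.ups u ≤ S.ups u :=
    mul_le_of_le_one_left (S.ups_nonneg u) (pow_le_one₀ h0.le h1.le)
  linarith [hu.2.2.1]

theorem exists_length_le : ∃ A : ℝ, 0 < A ∧ ∀ τ : ℝ, 0 < τ → τ ≤ 1 → ∀ w ∈ S.Zset τ,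
    (w.length : ℝ) ≤ A * (1 - Real.log τ) := by
  obtain ⟨θ, h0, h1, hθ⟩ := S.exists_ups_decay
  obtain ⟨U, hU1, hU⟩ := exists_le_bound fun a : Fin (2 * S.r) => S.ups [a]
  have hl : 0 < -Real.log θ := by linarith [Real.log_neg h0 h1]
  have hUl := Real.log_nonneg hU1
  refine ⟨2 + (Real.log U + 1) / (-Real.log θ), by positivity, fun τ hτ hτ1 w hw => ?_⟩
  have hlt : Real.log τ ≤ 0 := Real.log_nonpos hτ.le hτ1
  have hlen : w.length = w.dropLast.length + 1 := by
    have := List.length_pos_of_ne_nil hw.2.1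
    rw [List.length_dropLast]; omega
  have hword : IsWord w.dropLast := List.IsChain.prefix hw.1 (List.dropLast_prefix w)
  cases hd : w.dropLast with
  | nil =>
    rw [hd] at hlen
    have : (0 : ℝ) ≤ (Real.log U + 1) / (-Real.log θ) := by positivity
    rw [hlen]
    simp only [List.length_nil, zero_add, Nat.cast_one]
    nlinarith
  | cons a t =>
    have h2 := hw.2.2.2
    rw [hd] at h2 hword hlen
    have h3 := hθ [a] t (by simp) hword
    have h4 : τ < θ ^ t.length * U :=
      h2.trans_le (h3.trans (mul_le_mul_of_nonneg_left (hU a) (by positivity)))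
    have h5 := Real.log_lt_log hτ h4
    rw [Real.log_mul (by positivity) (by positivity), Real.log_pow] at h5
    have h6 : (t.length : ℝ) ≤ (Real.log U - Real.log τ) / (-Real.log θ) := by
      rw [le_div_iff₀ hl]; linarith
    have h7 : (Real.log U - Real.log τ) / (-Real.log θ) ≤
        (Real.log U + 1) / (-Real.log θ) * (1 - Real.log τ) := by
      rw [div_mul_eq_mul_div]
      gcongr
      nlinarith
    rw [hlen]
    simp only [List.length_cons]
    push_cast
    nlinarith

theorem finite_Zset {τ : ℝ} (hτ : 0 < τ) (hτ1 : τ ≤ 1) : (S.Zset τ).Finite := by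
  obtain ⟨A, -, hA⟩ := S.exists_length_le
  refine Set.Finite.subset (List.finite_length_le (Fin (2 * S.r)) ⌊A * (1 - Real.log τ)⌋₊) ?_
  intro w hw
  exact Nat.le_floor (hA τ hτ hτ1 w hw)

/-- Words of `Z(τ)`, prolonged by one letter, contract at most by a constant times `τ`. -/
theorem exists_expansion : ∃ κ : ℝ, 0 < κ ∧ κ < 1 ∧ ∀ τ : ℝ, 0 < τ → τ ≤ 1 → ∀ w ∈ S.Zset τ,
    ∀ c a : Fin (2 * S.r), IsWord (w ++ [c] ++ [a]) → ∀ x ∈ S.Iclosed a, ∀ y ∈ S.Iclosed a,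
      κ * τ * |x - y| ≤ |mobiusR (S.wprod (w ++ [c])) x - mobiusR (S.wprod (w ++ [c])) y| := by
  obtain ⟨d, hd, R, hR, hdist⟩ := S.exists_distortion
  obtain ⟨k₁, hk₁, k₂, hk₂, hups⟩ := S.exists_ups_bounds
  obtain ⟨K, hK, hrow⟩ := S.exists_rowSize_mul_le
  have key : ∀ τ : ℝ, 0 < τ → τ ≤ 1 → ∀ w ∈ S.Zset τ,
      τ * rowSize (S.wprod w.dropLast) ^ 2 ≤ (1 + k₂) * K ^ 2 := by
    intro τ hτ hτ1 w hw
    rcases List.eq_nil_or_concat w.dropLast with h | ⟨v, b, h⟩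
    · rw [h, wprod_nil, rowSize_one]
      have : 1 ≤ K ^ 2 := one_le_pow₀ hK
      nlinarith
    · have h2 := hw.2.2.2
      have hword : IsWord w.dropLast := List.IsChain.prefix hw.1 (List.dropLast_prefix w)
      rw [List.concat_eq_append] at h
      rw [h] at h2 hword ⊢
      have h3 := h2.le.trans (hups v b hword).2
      have hN := rowSize_pos (S.wprod v)
      rw [le_div_iff₀ (by positivity)] at h3
      have h4 := hrow v b
      calc τ * rowSize (S.wprod (v ++ [b])) ^ 2 ≤ τ * (K * rowSize (S.wprod v)) ^ 2 := by
            gcongr; exact (rowSize_pos _).le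
        _ = (τ * rowSize (S.wprod v) ^ 2) * K ^ 2 := by ring
        _ ≤ (1 + k₂) * K ^ 2 := by gcongr; linarith
  have hK0 : 0 < K := by linarith
  have hR0 : 0 < R := by linarith
  refine ⟨1 / (2 * (R ^ 2 * K ^ 4 * ((1 + k₂) * K ^ 2))), by positivity, ?_, ?_⟩
  · rw [div_lt_one (by positivity)]
    have e1 : 1 ≤ R ^ 2 := one_le_pow₀ hR
    have e2 : 1 ≤ K ^ 4 := one_le_pow₀ hK
    have e3 : 1 ≤ K ^ 2 := one_le_pow₀ hK
    have e4 : 1 ≤ (1 + k₂) * K ^ 2 := one_le_mul_of_one_le_of_one_le (by linarith) e3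
    have e5 := one_le_mul_of_one_le_of_one_le (one_le_mul_of_one_le_of_one_le e1 e2) e4
    linarith
  · intro τ hτ hτ1 w hw c a hword x hx y hy
    have h1 := S.denomR_ne_zero hword hx
    have h2 := S.denomR_ne_zero hword hy
    have h3 := (hdist _ _ hword x hx).2
    have h4 := (hdist _ _ hword y hy).2
    rw [mobiusR_sub _ h1 h2, abs_div, le_div_iff₀ (abs_pos.2 (mul_ne_zero h1 h2)), abs_mul]
    have h5 : rowSize (S.wprod (w ++ [c])) ≤ K ^ 2 * rowSize (S.wprod w.dropLast) := by
      have e1 := hrow w c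
      have e2 := hrow w.dropLast (w.getLast hw.2.1)
      rw [List.dropLast_append_getLast] at e2
      nlinarith
    have h6 := key τ hτ hτ1 w hw
    have hN := rowSize_pos (S.wprod w.dropLast)
    have hN' := rowSize_pos (S.wprod (w ++ [c]))
    set N := rowSize (S.wprod w.dropLast)
    set N' := rowSize (S.wprod (w ++ [c]))
    have h7 : |denomR (S.wprod (w ++ [c])) x| * |denomR (S.wprod (w ++ [c])) y| ≤
        R ^ 2 * K ^ 4 * N ^ 2 := by
      calc _ ≤ (R * N') * (R * N') := mul_le_mul h3 h4 (abs_nonneg _) (by positivity)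
        _ ≤ (R * (K ^ 2 * N)) * (R * (K ^ 2 * N)) := by gcongr
        _ = _ := by ring
    have h8 : τ * (|denomR (S.wprod (w ++ [c])) x| * |denomR (S.wprod (w ++ [c])) y|) ≤
        R ^ 2 * K ^ 4 * ((1 + k₂) * K ^ 2) := by
      calc _ ≤ τ * (R ^ 2 * K ^ 4 * N ^ 2) := by gcongr
        _ = R ^ 2 * K ^ 4 * (τ * N ^ 2) := by ring
        _ ≤ _ := by gcongr
    set M := R ^ 2 * K ^ 4 * ((1 + k₂) * K ^ 2) with hM
    have hM0 : 0 < M := by positivity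
    calc 1 / (2 * M) * τ * |x - y| * (|denomR (S.wprod (w ++ [c])) x| *
          |denomR (S.wprod (w ++ [c])) y|)
        = 1 / (2 * M) * |x - y| * (τ * (|denomR (S.wprod (w ++ [c])) x| *
          |denomR (S.wprod (w ++ [c])) y|)) := by ring
      _ ≤ 1 / (2 * M) * |x - y| * M := by gcongr
      _ = |x - y| / 2 := by field_simp
      _ ≤ |x - y| := by linarith [abs_nonneg (x - y)]

end Schottky

namespace Schottky

variable (S : Schottky)

theorem TS_mobiusR {a z : Fin (2 * S.r)} {t : List (Fin (2 * S.r))}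
    (hw : IsWord (a :: t ++ [z])) {x : ℝ} (hx : x ∈ S.Iclosed z) :
    S.TS ((mobiusR (S.wprod (a :: t)) x : ℂ) : OnePoint ℂ) =
      ((mobiusR (S.wprod t) x : ℂ) : OnePoint ℂ) := by
  have hin := S.mobiusR_mem_Ireal hw hx
  have hex : ∃ b : Fin (2 * S.r), ∃ w : ℂ,
      ((mobiusR (S.wprod (a :: t)) x : ℂ) : OnePoint ℂ) = (w : OnePoint ℂ) ∧ w ∈ S.D b :=
    ⟨a, _, rfl, hin⟩
  have hch : hex.choose = a := by
    obtain ⟨w, hw1, hw2⟩ := hex.choose_spec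
    rw [OnePoint.coe_eq_coe] at hw1
    by_contra hne
    refine S.Ireal_disjoint (Ne.symm hne) (S.Ireal_subset_Iclosed a hin)
      (S.Ireal_subset_Iclosed _ ?_)
    rw [← hw1] at hw2
    exact hw2
  have hw' : IsWord (t ++ [z]) := IsWord.right (u := [a]) hw
  have hp1 := S.denomR_ne_zero hw hx
  have hp2 := S.denomR_ne_zero hw' hx
  rw [← planeAct_vec_one] at hp1 hp2
  rw [TS, dif_pos hex, hch, mobiusR_eq, mobiusS_div _ hp1, mobiusR_eq, wprod_cons, mul_planeAct,
    inv_planeAct_planeAct, if_neg hp2]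

theorem TS_iterate_mobiusR {z : Fin (2 * S.r)} {x : ℝ} (hx : x ∈ S.Iclosed z) (m : ℕ) :
    ∀ V : List (Fin (2 * S.r)), IsWord (V ++ [z]) → m ≤ V.length →
      (S.TS)^[m] ((mobiusR (S.wprod V) x : ℂ) : OnePoint ℂ) =
        ((mobiusR (S.wprod (V.drop m)) x : ℂ) : OnePoint ℂ) := by
  induction m with
  | zero => intro V _ _; rfl
  | succ m ih =>
    intro V hV hm
    cases V with
    | nil => simp at hm
    | cons a t =>
      rw [Function.iterate_succ_apply, S.TS_mobiusR hV hx, List.drop_succ_cons]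
      exact ih t (IsWord.right (u := [a]) hV) (by simpa using hm)

theorem mem_limitSetR_of_forall {x : ℝ} (h : ∀ n : ℕ, ∃ (V : List (Fin (2 * S.r)))
    (z : Fin (2 * S.r)) (y : ℝ), IsWord (V ++ [z]) ∧ n < V.length ∧ y ∈ S.Iclosed z ∧
      x = mobiusR (S.wprod V) y) : x ∈ S.limitSetR := by
  intro n
  obtain ⟨V, z, y, hV, hn, hy, rfl⟩ := h n
  refine ⟨_, S.TS_iterate_mobiusR hy n V hV hn.le, ?_⟩
  have h1 := List.drop_eq_getElem_cons hn
  have h2 : IsWord (V.drop n ++ [z]) := by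
    rw [← List.take_append_drop n V, List.append_assoc] at hV
    exact hV.right
  rw [h1] at h2 ⊢
  exact Set.mem_iUnion.2 ⟨_, S.mobiusR_mem_Ireal h2 hy⟩

theorem delta_nonneg : 0 ≤ S.delta := ENNReal.toReal_nonneg

theorem dimH_limitSetR_le : (dimH S.limitSetR).toReal ≤ S.delta := by
  have h1 : dimH S.limitSetR ≤ dimH S.limitSet := by
    rw [← Complex.isometry_ofReal.dimH_image]
    exact dimH_mono (by rintro _ ⟨x, hx, rfl⟩; exact hx)
  have h2 : dimH S.limitSet ≠ ⊤ := by
    refine ne_top_of_le_ne_top ?_ (dimH_mono (Set.subset_univ _))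
    rw [Real.dimH_univ_eq_finrank]
    exact ENNReal.natCast_ne_top _
  exact ENNReal.toReal_mono h2 h1

theorem ifsIter_eq_mobiusR {a c : Fin (2 * S.r)} {M : ℕ} (W : Fin M → List (Fin (2 * S.r)))
    (hW : ∀ i, IsWord (W i ++ [c] ++ [a])) (hhead : ∀ i, (W i).head? = some a)
    (s : ℕ → Fin M) (k : ℕ) : ∃ V : List (Fin (2 * S.r)), IsWord (V ++ [a]) ∧ k ≤ V.length ∧
      ∀ x ∈ S.Iclosed a, ifsIter (fun i => mobiusR (S.wprod (W i ++ [c]))) s k x =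
        mobiusR (S.wprod V) x := by
  induction k with
  | zero =>
    refine ⟨[], List.isChain_singleton a, le_rfl, fun x _ => ?_⟩
    simp [ifsIter, wprod_nil, mobiusR]
  | succ k ih =>
    obtain ⟨V, hV, hk, h⟩ := ih
    have hmem : ∀ x ∈ S.Iclosed a, mobiusR (S.wprod (W (s k) ++ [c])) x ∈ S.Iclosed a := by
      intro x hx
      have h1 := hW (s k)
      have h2 := hhead (s k)
      cases hw : W (s k) with
      | nil => simp [hw] at h2
      | cons b t =>
        rw [hw] at h1 h2
        simp at h2
        subst h2
        exact S.Ireal_subset_Iclosed _ (S.mobiusR_mem_Ireal (v := t ++ [c]) h1 hx)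
    refine ⟨V ++ (W (s k) ++ [c]), ?_, ?_, fun x hx => ?_⟩
    · rw [List.append_assoc]
      refine isWord_append.2 ⟨hV.left, hW _, ?_⟩
      intro y hy w hw
      refine (isWord_append.1 hV).2.2 y hy w ?_
      have := hhead (s k)
      simp [List.head?_append, this] at hw
      simp [hw]
    · simp; omega
    · rw [ifsIter, Function.comp_apply, h _ (hmem x hx), S.mobiusR_wprod_append (hW _) hx]

theorem mobiusR_image_disjoint {τ : ℝ} {c a : Fin (2 * S.r)} {u v : List (Fin (2 * S.r))}
    (hu : u ∈ S.Zset τ) (hv : v ∈ S.Zset τ) (huv : u ≠ v) (hu' : IsWord (u ++ [c] ++ [a]))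
    (hv' : IsWord (v ++ [c] ++ [a])) :
    Disjoint (mobiusR (S.wprod (u ++ [c])) '' S.Iclosed a)
      (mobiusR (S.wprod (v ++ [c])) '' S.Iclosed a) := by
  rw [Set.disjoint_left]
  rintro _ ⟨x, hx, rfl⟩ ⟨y, hy, hxy⟩
  have adm : ∀ w : List (Fin (2 * S.r)), IsWord (w ++ [c] ++ [a]) → ∀ x ∈ S.Iclosed a,
      S.Admissible w (planeAct (S.wprod [c]) ![x, 1]) := by
    intro w hw x hx z hz
    have h1 := S.isWord_pair hw
    have h2 : S.Inner c (planeAct (S.wprod [c]) ![x, 1]) :=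
      S.wprod_inner (a := c) (u := []) h1.left (S.admissible_of_mem h1 hx)
    refine h2.outer fun h => ?_
    refine (isWord_append.1 hw.left).2.2 z hz c (by simp) ?_
    rw [h, wordBar_wordBar]
  have h1 := S.denomR_ne_zero hu' hx
  have h2 := S.denomR_ne_zero hv' hy
  rw [← planeAct_vec_one] at h1 h2
  rw [mobiusR_eq, mobiusR_eq] at hxy
  have h3 : planeAct (S.wprod (u ++ [c])) ![x, 1] =
      (planeAct (S.wprod (u ++ [c])) ![x, 1] 1 / planeAct (S.wprod (v ++ [c])) ![y, 1] 1) •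
        planeAct (S.wprod (v ++ [c])) ![y, 1] := by
    ext i
    fin_cases i
    · simp only [Fin.zero_eta, Pi.smul_apply, smul_eq_mul]
      field_simp at hxy ⊢
      linarith
    · simp only [Fin.mk_one, Pi.smul_apply, smul_eq_mul]
      field_simp
  have h4 := div_ne_zero h1 h2
  rw [wprod_append, wprod_append, mul_planeAct, mul_planeAct] at h3
  rw [wprod_append, wprod_append, mul_planeAct, mul_planeAct] at h4
  rcases S.prefix_of_smul_eq hu.1 hv.1 (adm u hu' x hx) (adm v hv' y hy) h4 h3 with h | h
  · exact huv (S.eq_of_prefix_of_mem_Zset hu hv h)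
  · exact huv (S.eq_of_prefix_of_mem_Zset hv hu h).symm

theorem exists_ncard_Zset_le : ∃ C : ℝ, 0 < C ∧ ∀ τ : ℝ, 0 < τ → τ ≤ 1 →
    ((S.Zset τ).ncard : ℝ) ≤ C * τ ^ (-S.delta) := by
  obtain ⟨κ, hκ0, hκ1, hκ⟩ := S.exists_expansion
  refine ⟨((2 * S.r * (2 * S.r) : ℕ) : ℝ) * κ ^ (-S.delta), ?_, fun τ hτ hτ1 => ?_⟩
  · have := S.two_le_r
    have : 0 < 2 * S.r * (2 * S.r) := by positivity
    have : (0 : ℝ) < ((2 * S.r * (2 * S.r) : ℕ) : ℝ) := by exact_mod_cast this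
    positivity
  have hfin := S.finite_Zset hτ hτ1
  have hρ0 : 0 < κ * τ := by positivity
  have hρ1 : κ * τ < 1 := by nlinarith
  have key : ∀ p : Fin (2 * S.r) × Fin (2 * S.r),
      ((hfin.toFinset.filter fun w => w.head? = some p.1 ∧ w.getLast? = some p.2).card : ℝ) ≤
        (κ * τ) ^ (-S.delta) := by
    rintro ⟨a, b⟩
    have hge1 : (1 : ℝ) ≤ (κ * τ) ^ (-S.delta) :=
      Real.one_le_rpow_of_pos_of_le_one_of_nonpos hρ0 hρ1.le (by linarith [S.delta_nonneg])
    set F := hfin.toFinset.filter fun w => w.head? = some a ∧ w.getLast? = some b with hF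
    rcases le_or_gt F.card 1 with hM | hM
    · exact le_trans (by exact_mod_cast hM) hge1
    obtain ⟨c, hc1, hc2⟩ := exists_letter_ne S.two_le_r (wordBar b) (wordBar a)
    let W : Fin F.card → List (Fin (2 * S.r)) := fun i => (F.equivFin.symm i).1
    have hWF : ∀ i, W i ∈ F := fun i => (F.equivFin.symm i).2
    have hWinj : Function.Injective W := Subtype.val_injective.comp F.equivFin.symm.injective
    have hZ : ∀ i, W i ∈ S.Zset τ := fun i => by
      have := hWF i
      simp only [hF, Finset.mem_filter, Set.Finite.mem_toFinset] at this
      exact this.1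
    have hhead : ∀ i, (W i).head? = some a := fun i => (Finset.mem_filter.1 (hWF i)).2.1
    have hlast : ∀ i, (W i).getLast? = some b := fun i => (Finset.mem_filter.1 (hWF i)).2.2
    have hword : ∀ i, IsWord (W i ++ [c] ++ [a]) := by
      intro i
      refine isWord_concat (isWord_append.2 ⟨(hZ i).1, List.isChain_singleton c, ?_⟩) hc2
      intro x hx y hy
      rw [hlast i] at hx
      simp at hx hy
      subst hx hy
      exact fun h => hc1 (by rw [h, wordBar_wordBar])
    have hcount := card_le_rpow_of_ifs (φ := fun i => mobiusR (S.wprod (W i ++ [c])))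
      (J := S.Iclosed a) (ρ := κ * τ) hM hρ0 hρ1 isCompact_Icc ⟨_, S.left_mem_Iclosed a⟩
      (fun i x hx => by
        have h1 := hword i
        have h2 := hhead i
        cases hw : W i with
        | nil => simp [hw] at h2
        | cons b t =>
          rw [hw] at h1 h2
          simp at h2
          subst h2
          exact S.Ireal_subset_Iclosed _ (S.mobiusR_mem_Ireal (v := t ++ [c]) h1 hx))
      (fun i => S.continuousOn_mobiusR (hword i))
      (fun i => hκ τ hτ hτ1 _ (hZ i) c a (hword i))
      (fun i j hij => S.mobiusR_image_disjoint (hZ i) (hZ j) (hWinj.ne hij) (hword i) (hword j))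
      (Λ := S.limitSetR) (fun x ⟨s, hs⟩ => S.mem_limitSetR_of_forall fun n => by
        obtain ⟨V, hV, hk, h⟩ := S.ifsIter_eq_mobiusR W hword hhead s (n + 1)
        obtain ⟨y, hy, rfl⟩ := hs (n + 1)
        exact ⟨V, a, y, hV, hk, hy, h y hy⟩)
    exact hcount.trans (Real.rpow_le_rpow_of_exponent_ge hρ0 hρ1.le
      (by linarith [S.dimH_limitSetR_le]))
  have hcover : hfin.toFinset ⊆ (Finset.univ : Finset (Fin (2 * S.r) × Fin (2 * S.r))).biUnion
      fun p => hfin.toFinset.filter fun w => w.head? = some p.1 ∧ w.getLast? = some p.2 := by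
    intro w hw
    have hne : w ≠ [] := ((Set.Finite.mem_toFinset _).1 hw).2.1
    exact Finset.mem_biUnion.2 ⟨(w.head hne, w.getLast hne), Finset.mem_univ _,
      Finset.mem_filter.2 ⟨hw, List.head?_eq_some_head hne, List.getLast?_eq_some_getLast hne⟩⟩
  rw [Set.ncard_eq_toFinset_card _ hfin]
  calc (hfin.toFinset.card : ℝ)
      ≤ ((∑ p : Fin (2 * S.r) × Fin (2 * S.r), (hfin.toFinset.filter fun w =>
          w.head? = some p.1 ∧ w.getLast? = some p.2).card : ℕ) : ℝ) := by
        exact_mod_cast (Finset.card_le_card hcover).trans Finset.card_biUnion_le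
    _ ≤ ∑ _p : Fin (2 * S.r) × Fin (2 * S.r), (κ * τ) ^ (-S.delta) := by
        push_cast
        exact Finset.sum_le_sum fun p _ => key p
    _ = ((2 * S.r * (2 * S.r) : ℕ) : ℝ) * κ ^ (-S.delta) * τ ^ (-S.delta) := by
        rw [Finset.sum_const, Finset.card_univ, Fintype.card_prod, Fintype.card_fin, nsmul_eq_mul,
          Real.mul_rpow hκ0.le hτ.le]
        ring

theorem mirror_mem_Zbar {τ : ℝ} {w : List (Fin (2 * S.r))} :
    mirror w ∈ S.Zbar τ ↔ w ∈ S.Zset τ := by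
  constructor
  · intro h
    have := h.2
    rwa [mirror_mirror] at this
  · intro h
    exact ⟨isWord_mirror h.1, by rwa [mirror_mirror]⟩

theorem Zbar_eq_image (τ : ℝ) : S.Zbar τ = mirror '' S.Zset τ := by
  ext w
  constructor
  · intro h
    exact ⟨mirror w, h.2, mirror_mirror w⟩
  · rintro ⟨v, hv, rfl⟩
    exact S.mirror_mem_Zbar.2 hv

end Schottky

namespace Schottky

variable (S : Schottky)

theorem finite_Zbar {τ : ℝ} (hτ : 0 < τ) (hτ1 : τ ≤ 1) : (S.Zbar τ).Finite := by
  rw [Zbar_eq_image]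
  exact (S.finite_Zset hτ hτ1).image _

theorem ncard_Zbar (τ : ℝ) : (S.Zbar τ).ncard = (S.Zset τ).ncard := by
  rw [Zbar_eq_image]
  exact Set.ncard_image_of_injective _ (Function.LeftInverse.injective mirror_mirror)

theorem ne_nil_of_mem_Zbar {τ : ℝ} {w : List (Fin (2 * S.r))} (hw : w ∈ S.Zbar τ) : w ≠ [] := by
  rintro rfl
  exact hw.2.2.1 rfl

theorem isWord_dropLast {r : ℕ} {w : List (Fin (2 * r))} (hw : IsWord w) : IsWord w.dropLast :=
  List.IsChain.prefix hw (List.dropLast_prefix w)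

theorem exists_length_bound {ε α : ℝ} (hε : 0 < ε) (hα : 0 < α) : ∃ n₀ : ℕ, ∀ n : ℕ, n₀ ≤ n →
    1 ≤ n ∧ ∃ L : ℝ, 1 ≤ L ∧ 8 * L ≤ n ∧ 18 * (2 * L) ^ 4 ≤ (n : ℝ) ^ ε ∧
      ∀ w ∈ S.Zset ((n : ℝ) ^ (-α)), (w.length : ℝ) ≤ L := by
  obtain ⟨A, hA, hlen⟩ := S.exists_length_le
  set B := (A + 1) * (1 + α) with hB
  have hB1 : 1 ≤ B := one_le_mul_of_one_le_of_one_le (by linarith) (by linarith)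
  have hB0 : 0 < B := by linarith
  have h1 := (isLittleO_log_rpow_rpow_atTop 1 (one_pos : (0 : ℝ) < 1)).bound
    (show 0 < 1 / (8 * B) by positivity)
  have h2 := (isLittleO_log_rpow_rpow_atTop 4 hε).bound
    (show 0 < 1 / (18 * (2 * B) ^ 4) by positivity)
  have h3 : ∀ᶠ x : ℝ in Filter.atTop, 1 ≤ Real.log x :=
    Real.tendsto_log_atTop.eventually_ge_atTop 1
  have h4 : ∀ᶠ x : ℝ in Filter.atTop, 1 ≤ x := Filter.eventually_ge_atTop 1
  obtain ⟨n₀, hn₀⟩ := Filter.eventually_atTop.1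
    (tendsto_natCast_atTop_atTop.eventually (h1.and (h2.and (h3.and h4))))
  refine ⟨n₀, fun n hn => ?_⟩
  obtain ⟨e1, e2, e3, e4⟩ := hn₀ n hn
  have hn0 : (0 : ℝ) < n := by linarith
  have hlog : 0 ≤ Real.log n := by linarith
  refine ⟨by exact_mod_cast e4, B * Real.log n, ?_, ?_, ?_, ?_⟩
  · exact one_le_mul_of_one_le_of_one_le hB1 e3
  · rw [Real.rpow_one, Real.rpow_one, Real.norm_of_nonneg hlog, Real.norm_of_nonneg hn0.le,
      div_mul_eq_mul_div, one_mul, le_div_iff₀ (by positivity)] at e1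
    linarith
  · rw [Real.norm_of_nonneg (by positivity), Real.norm_of_nonneg (by positivity),
      div_mul_eq_mul_div, one_mul, le_div_iff₀ (by positivity)] at e2
    have : Real.log n ^ (4 : ℝ) = Real.log n ^ 4 := by
      rw [← Real.rpow_natCast]; norm_num
    rw [this] at e2
    calc _ = Real.log n ^ 4 * (18 * (2 * B) ^ 4) := by ring
      _ ≤ _ := e2
  · intro w hw
    have h := hlen _ (by positivity) (Real.rpow_le_one_of_one_le_of_nonpos e4 (by linarith)) w hw
    rw [Real.log_rpow hn0] at h
    refine h.trans ?_
    rw [hB]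
    have : A * (1 - -α * Real.log n) ≤ A * ((1 + α) * Real.log n) := by gcongr; nlinarith
    refine this.trans ?_
    rw [mul_assoc]
    gcongr
    linarith

open Classical in
theorem card_filter_wprod_eq_le (Z : Finset (List (Fin (2 * S.r)))) (hZ : ∀ w ∈ Z, IsWord w)
    (hne : ∀ w ∈ Z, w ≠ []) (u : List (Fin (2 * S.r))) (hu : u ∈ Z) :
    (Z.filter fun v => S.wprod u.dropLast * (S.wprod v.dropLast)⁻¹ = 1).card ≤ 2 * S.r := by
  have : (Z.filter fun v => S.wprod u.dropLast * (S.wprod v.dropLast)⁻¹ = 1).card ≤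
      (Finset.univ.image fun a : Fin (2 * S.r) => u.dropLast ++ [a]).card := by
    refine Finset.card_le_card fun v hv => ?_
    obtain ⟨hv, h⟩ := Finset.mem_filter.1 hv
    have := S.wprod_injective (isWord_dropLast (hZ u hu)) (isWord_dropLast (hZ v hv))
      (mul_inv_eq_one.1 h)
    refine Finset.mem_image.2 ⟨v.getLast (hne v hv), Finset.mem_univ _, ?_⟩
    rw [this, List.dropLast_append_getLast]
  refine this.trans (Finset.card_image_le.trans ?_)
  simp

open Classical in
theorem abs_meanFix_pair_le {n : ℕ} (hn : 1 ≤ n) {ε τ L : ℝ} (hL : 1 ≤ L) (hLn : 8 * L ≤ n)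
    (hLε : 18 * (2 * L) ^ 4 ≤ (n : ℝ) ^ ε) (hlen : ∀ w ∈ S.Zset τ, (w.length : ℝ) ≤ L)
    {u v : List (Fin (2 * S.r))} (hu : u ∈ S.Zbar τ) (hv : v ∈ S.Zbar τ) :
    |meanFix n (u.dropLast ++ mirror v.dropLast) - 1| ≤
      (n : ℝ) * (if S.wprod u.dropLast * (S.wprod v.dropLast)⁻¹ = 1 then 1 else 0) +
      (n : ℝ) ^ ε * (if (u, v) ∈ S.PowerPairs τ then 1 else 0) + (n : ℝ) ^ (ε - 1) := by
  have hn0 : (0 : ℝ) < n := by exact_mod_cast hn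
  have hlen' : ∀ w ∈ S.Zbar τ, (w.dropLast.length : ℝ) ≤ L := by
    intro w hw
    have h := hlen _ hw.2
    rw [length_mirror] at h
    refine le_trans ?_ h
    rw [List.length_dropLast]
    exact_mod_cast Nat.sub_le _ _
  by_cases h1 : S.wprod u.dropLast * (S.wprod v.dropLast)⁻¹ = 1
  · rw [if_pos h1, mul_one, add_assoc]
    exact (abs_meanFix_sub_one_le hn _).trans (le_add_of_nonneg_right (by positivity))
  rw [if_neg h1, mul_zero, zero_add]
  obtain ⟨h2, h3⟩ := (S.meanFix_pair_cases u.dropLast v.dropLast).resolve_left h1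
  have hsum : (u.dropLast.length : ℝ) + v.dropLast.length ≤ 2 * L := by
    linarith [hlen' u hu, hlen' v hv]
  have hn4 : 4 * (u.dropLast.length + v.dropLast.length) ≤ n := by
    have : (4 : ℝ) * ((u.dropLast.length : ℝ) + v.dropLast.length) ≤ n := by linarith
    exact_mod_cast this
  rcases h3 with h3 | h3
  · have hP : (u, v) ∈ S.PowerPairs τ := ⟨hu, hv, h1, h3⟩
    rw [if_pos hP, mul_one]
    refine (h2 n hn4).trans (le_trans ?_ (le_add_of_nonneg_right (by positivity)))
    refine le_trans ?_ hLε
    have e1 : ((u.dropLast.length : ℝ) + v.dropLast.length) ^ 2 ≤ (2 * L) ^ 2 := by gcongr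
    have e2 : 1 ≤ (2 * L) ^ 2 := one_le_pow₀ (by linarith)
    nlinarith
  · refine (h3 n hn4).trans (le_trans ?_ (le_add_of_nonneg_left (by positivity)))
    rw [Real.rpow_sub hn0, Real.rpow_one]
    gcongr
    refine le_trans ?_ hLε
    gcongr

end Schottky

/-- with `τ = n^{−α}`, the sum over `𝐚, 𝐛 ∈ Z̄(τ)` of
`|E[fix(Π(𝐚')Π(𝐛')⁻¹)] − 1|` is at most
`C (n τ^{−δ} + n^ε #PowerPairs(τ) + n^{ε−1} τ^{−2δ})`. -/
theorem stmt_18 (S : Schottky) :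
    ∃ C : ℝ, 0 < C ∧
      ∀ ε α : ℝ, 0 < ε → 0 < α →
        ∃ n₀ : ℕ, ∀ n : ℕ, n₀ ≤ n →
          (∑ᶠ w ∈ S.Zbar ((n : ℝ) ^ (-α)), ∑ᶠ v ∈ S.Zbar ((n : ℝ) ^ (-α)),
            |(∑ σ : Fin S.r → Equiv.Perm (Fin n),
                (fixCount (wordPerm σ w.dropLast * (wordPerm σ v.dropLast)⁻¹) : ℝ)) /
              (Fintype.card (Fin S.r → Equiv.Perm (Fin n)) : ℝ) - 1|)
          ≤ C * ((n : ℝ) * ((n : ℝ) ^ (-α)) ^ (-S.delta)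
              + (n : ℝ) ^ ε * ((S.PowerPairs ((n : ℝ) ^ (-α))).ncard : ℝ)
              + (n : ℝ) ^ (ε - 1) * ((n : ℝ) ^ (-α)) ^ (-(2 * S.delta))) := by
  classical
  obtain ⟨C₀, hC₀, hcard⟩ := S.exists_ncard_Zset_le
  refine ⟨2 * S.r * C₀ + 1 + C₀ ^ 2, by positivity, fun ε α hε hα => ?_⟩
  obtain ⟨n₀, hn₀⟩ := S.exists_length_bound hε hα
  refine ⟨n₀, fun n hn => ?_⟩
  obtain ⟨hn1, L, hL, hLn, hLε, hlen⟩ := hn₀ n hn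
  have hn0 : (0 : ℝ) < n := by exact_mod_cast hn1
  have hτ : 0 < (n : ℝ) ^ (-α) := by positivity
  have hτ1 : (n : ℝ) ^ (-α) ≤ 1 :=
    Real.rpow_le_one_of_one_le_of_nonpos (by exact_mod_cast hn1) (by linarith)
  set τ := (n : ℝ) ^ (-α)
  have hfin := S.finite_Zbar hτ hτ1
  set Z := hfin.toFinset with hZdef
  have hZ : ∀ w, w ∈ Z ↔ w ∈ S.Zbar τ := fun w => Set.Finite.mem_toFinset _
  have hZcard : (Z.card : ℝ) ≤ C₀ * τ ^ (-S.delta) := by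
    rw [hZdef, ← Set.ncard_eq_toFinset_card _ hfin, S.ncard_Zbar]
    exact hcard τ hτ hτ1
  simp only [S.mean_fixCount_eq, finsum_mem_eq_finite_toFinset_sum _ hfin]
  have htriv : ∑ u ∈ Z, ∑ v ∈ Z,
      (if S.wprod u.dropLast * (S.wprod v.dropLast)⁻¹ = 1 then (1 : ℝ) else 0) ≤
        Z.card * (2 * S.r) := by
    rw [← nsmul_eq_mul]
    refine Finset.sum_le_card_nsmul _ _ _ fun u hu => ?_
    rw [Finset.sum_boole]
    exact_mod_cast S.card_filter_wprod_eq_le Z (fun w hw => ((hZ w).1 hw).1)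
      (fun w hw => S.ne_nil_of_mem_Zbar ((hZ w).1 hw)) u hu
  have hpow : ∑ u ∈ Z, ∑ v ∈ Z, (if (u, v) ∈ S.PowerPairs τ then (1 : ℝ) else 0) ≤
      (S.PowerPairs τ).ncard := by
    rw [← Finset.sum_product' Z Z fun u v => if (u, v) ∈ S.PowerPairs τ then (1 : ℝ) else 0,
      Finset.sum_boole]
    have hPfin : (S.PowerPairs τ).Finite :=
      (hfin.prod hfin).subset fun p hp => ⟨hp.1, hp.2.1⟩
    rw [Set.ncard_eq_toFinset_card _ hPfin]
    exact_mod_cast Finset.card_le_card fun p hp =>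
      (Set.Finite.mem_toFinset _).2 (Finset.mem_filter.1 hp).2
  have hsq : (Z.card : ℝ) * Z.card ≤ C₀ ^ 2 * τ ^ (-(2 * S.delta)) := by
    have : τ ^ (-(2 * S.delta)) = τ ^ (-S.delta) * τ ^ (-S.delta) := by
      rw [← Real.rpow_add hτ]; congr 1; ring
    rw [this]
    calc _ ≤ (C₀ * τ ^ (-S.delta)) * (C₀ * τ ^ (-S.delta)) := by gcongr
      _ = _ := by ring
  calc ∑ u ∈ Z, ∑ v ∈ Z, |meanFix n (u.dropLast ++ mirror v.dropLast) - 1|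
      ≤ ∑ u ∈ Z, ∑ v ∈ Z,
        ((n : ℝ) * (if S.wprod u.dropLast * (S.wprod v.dropLast)⁻¹ = 1 then 1 else 0) +
          (n : ℝ) ^ ε * (if (u, v) ∈ S.PowerPairs τ then 1 else 0) + (n : ℝ) ^ (ε - 1)) :=
        Finset.sum_le_sum fun u hu => Finset.sum_le_sum fun v hv =>
          S.abs_meanFix_pair_le hn1 hL hLn hLε hlen ((hZ u).1 hu) ((hZ v).1 hv)
    _ = (n : ℝ) * (∑ u ∈ Z, ∑ v ∈ Z,
          (if S.wprod u.dropLast * (S.wprod v.dropLast)⁻¹ = 1 then (1 : ℝ) else 0)) +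
        (n : ℝ) ^ ε * (∑ u ∈ Z, ∑ v ∈ Z, (if (u, v) ∈ S.PowerPairs τ then (1 : ℝ) else 0)) +
        (n : ℝ) ^ (ε - 1) * (Z.card * Z.card) := by
        simp only [Finset.sum_add_distrib, ← Finset.mul_sum, Finset.sum_const, nsmul_eq_mul]
        ring
    _ ≤ (n : ℝ) * (C₀ * τ ^ (-S.delta) * (2 * S.r)) +
        (n : ℝ) ^ ε * (S.PowerPairs τ).ncard +
        (n : ℝ) ^ (ε - 1) * (C₀ ^ 2 * τ ^ (-(2 * S.delta))) := by
        gcongr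
        exact htriv.trans (by gcongr)
    _ ≤ _ := by
        set X := (n : ℝ) * τ ^ (-S.delta) with hX
        set Y := (n : ℝ) ^ ε * ((S.PowerPairs τ).ncard : ℝ)
        set W := (n : ℝ) ^ (ε - 1) * τ ^ (-(2 * S.delta)) with hW
        have hX0 : 0 ≤ X := by positivity
        have hY0 : 0 ≤ Y := by positivity
        have hW0 : 0 ≤ W := by positivity
        have hr : (0 : ℝ) ≤ 2 * S.r * C₀ := by positivity
        have e1 : (n : ℝ) * (C₀ * τ ^ (-S.delta) * (2 * S.r)) = 2 * S.r * C₀ * X := by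
          rw [hX]; ring
        have e2 : (n : ℝ) ^ (ε - 1) * (C₀ ^ 2 * τ ^ (-(2 * S.delta))) = C₀ ^ 2 * W := by
          rw [hW]; ring
        rw [e1, e2]
        have p1 := mul_nonneg hr hY0
        have p2 := mul_nonneg hr hW0
        have p3 := mul_nonneg (sq_nonneg C₀) hX0
        have p4 := mul_nonneg (sq_nonneg C₀) hY0
        linarith
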